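/- Let L be a proper continuous signature and let U be a separable continuous L-structure with the Urysohn property. Equip the automorphism group Aut(U) with the topology of pointwise convergence (a basic neighborhood of g ∈ Aut(U) is given by finitely many points x_1, …, x_n ∈ U and ε > 0 and consists of all h ∈ Aut(U) with d(g(x_i), h(x_i)) < ε for all i). Then Aut(U) contains a dense subgroup G isomorphic to Hall's universal locally finite group; that is, G is countable, locally finite (every finitely generated subgroup of G is finite), every finite group embeds into G, and every isomorphism between two finite subgroups of G is induced by conjugation by an element of G. -/

import Mathlib

namespace ContLogic

/-- A continuous signature with finitely many relation symbols, all of whose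
moduli of continuity are nondecreasing. -/
structure Sig : Type 1 where
  I : Type
  finI : Finite I
  n : I → ℕ
  n_pos : ∀ i, 1 ≤ n i
  u : (i : I) → Fin (n i) → ℝ → ℝ
  u_zero : ∀ i j, u i j 0 = 0
  u_nonneg : ∀ i j t, 0 ≤ u i j t
  u_pos : ∀ i j t, 0 < t → 0 < u i j t
  u_lim : ∀ i j, Filter.Tendsto (u i j) (nhdsWithin 0 (Set.Ioi 0)) (nhds 0)
  u_mono : ∀ i j, MonotoneOn (u i j) (Set.Ici 0)

/-- A continuous `L`-pre-structure: a metric space together with `[0,1]`-valued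
relations respecting the moduli of continuity. -/
structure PreStr (L : Sig) : Type 1 where
  M : Type
  d : M → M → ℝ
  d_self : ∀ x, d x x = 0
  d_eq_zero : ∀ x y, d x y = 0 → x = y
  d_comm : ∀ x y, d x y = d y x
  d_triangle : ∀ x y z, d x z ≤ d x y + d y z
  R : (i : L.I) → (Fin (L.n i) → M) → ℝ
  R_mem : ∀ i x, R i x ∈ Set.Icc (0 : ℝ) 1
  R_uc : ∀ (i : L.I) (j : Fin (L.n i)) (x y : Fin (L.n i) → M),
    (∀ k, k ≠ j → x k = y k) → |R i x - R i y| ≤ L.u i j (d (x j) (y j))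

/-- The metric of `A` is complete (every Cauchy sequence converges). -/
def PreStr.IsComplete {L : Sig} (A : PreStr L) : Prop :=
  ∀ f : ℕ → A.M,
    (∀ ε : ℝ, 0 < ε → ∃ N : ℕ, ∀ m ≥ N, ∀ n ≥ N, A.d (f m) (f n) < ε) →
    ∃ x : A.M, ∀ ε : ℝ, 0 < ε → ∃ N : ℕ, ∀ n ≥ N, A.d (f n) x < ε

/-- The metric of `A` is separable (there is a countable dense subset). -/
def PreStr.Separable {L : Sig} (A : PreStr L) : Prop :=
  ∃ D : Set A.M, D.Countable ∧ ∀ x : A.M, ∀ ε : ℝ, 0 < ε → ∃ y ∈ D, A.d x y < ε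

/-- `f` is an isomorphic embedding of continuous `L`-pre-structures. -/
def Emb {L : Sig} (A B : PreStr L) (f : A.M → B.M) : Prop :=
  Function.Injective f ∧
  (∀ x y : A.M, B.d (f x) (f y) = A.d x y) ∧
  (∀ (i : L.I) (x : Fin (L.n i) → A.M), B.R i (f ∘ x) = A.R i x)

/-- The amalgamation property for a class `K` of continuous `L`-pre-structures. -/
def HasAP {L : Sig} (K : PreStr L → Prop) : Prop :=
  ∀ (A P Q : PreStr L), K A → K P → K Q →
    ∀ (φ : A.M → P.M) (ψ : A.M → Q.M), Emb A P φ → Emb A Q ψ →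
      ∃ (N : PreStr L) (ι : P.M → N.M) (τ : Q.M → N.M),
        K N ∧ Emb P N ι ∧ Emb Q N τ ∧ ι ∘ φ = τ ∘ ψ

/-- The strong amalgamation property for a class `K`. -/
def HasSAP {L : Sig} (K : PreStr L → Prop) : Prop :=
  ∀ (A P Q : PreStr L), K A → K P → K Q →
    ∀ (φ : A.M → P.M) (ψ : A.M → Q.M), Emb A P φ → Emb A Q ψ →
      ∃ (N : PreStr L) (ι : P.M → N.M) (τ : Q.M → N.M),
        K N ∧ Emb P N ι ∧ Emb Q N τ ∧ ι ∘ φ = τ ∘ ψ ∧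
        Set.range ι ∩ Set.range τ = Set.range (ι ∘ φ) ∧
        Set.range ι ∩ Set.range τ = Set.range (τ ∘ ψ)

/-- The joint embedding property for a class `K`. -/
def HasJEP {L : Sig} (K : PreStr L → Prop) : Prop :=
  ∀ A B : PreStr L, K A → K B →
    ∃ (C : PreStr L) (f : A.M → C.M) (g : B.M → C.M), K C ∧ Emb A C f ∧ Emb B C g

/-- `I_{i,j} = { r ≥ 0 : u_{i,j}(r) < 1 }`. -/
def Sig.Ival (L : Sig) (i : L.I) (j : Fin (L.n i)) : Set ℝ :=
  {r : ℝ | 0 ≤ r ∧ L.u i j r < 1}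

/-- `L` is semiproper. -/
def Sig.Semiproper (L : Sig) : Prop :=
  (∀ i j, BddAbove (L.Ival i j)) ∧
  (∀ i j, ∀ r s : ℝ, r ∈ L.Ival i j → s ∈ L.Ival i j → r + s ∈ L.Ival i j →
    L.u i j r + L.u i j s ≤ L.u i j (r + s)) ∧
  (∀ i : L.I, 2 ≤ L.n i → ∀ j, ∃ K : ℝ, 0 < K ∧ ∀ r ∈ L.Ival i j, L.u i j r = K * r)

/-- `u` is upper semicontinuous on `J`. -/
def USCOn (u : ℝ → ℝ) (J : Set ℝ) : Prop :=
  ∀ x ∈ J, ∀ ε : ℝ, 0 < ε → ∃ δ : ℝ, 0 < δ ∧ ∀ x' ∈ J, |x' - x| < δ → u x' < u x + ε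

/-- `L` is proper. -/
def Sig.Proper (L : Sig) : Prop :=
  L.Semiproper ∧ ∀ i j, USCOn (L.u i j) (L.Ival i j)

/-- `L` is strongly semiproper. -/
def Sig.StronglySemiproper (L : Sig) : Prop :=
  L.Semiproper ∧
  ∀ i : L.I, L.n i = 1 → ∀ j : Fin (L.n i), ∀ r₁ r₂ : ℝ, 0 < r₁ → 0 < r₂ →
    r₁ + r₂ ∈ L.Ival i j →
    sInf (L.u i j '' Set.Ioi r₁) + sInf (L.u i j '' Set.Ioi r₂) ≤ L.u i j (r₁ + r₂)

/-- `L` is Lipschitz. -/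
def Sig.Lipschitz (L : Sig) : Prop :=
  ∀ i j, BddAbove (L.Ival i j) ∧ ∃ K : ℝ, 0 < K ∧ ∀ r ∈ L.Ival i j, L.u i j r = K * r

/-- `B` is a one-point extension of `A` along the embedding `e`. -/
def OnePointExt {L : Sig} (A B : PreStr L) (e : A.M → B.M) : Prop :=
  Emb A B e ∧ ∃ x : B.M, x ∉ Set.range e ∧ ∀ y : B.M, y ∈ Set.range e ∨ y = x

/-- `U` has the Urysohn property. -/
def HasUrysohn {L : Sig} (U : PreStr L) : Prop :=
  ∀ (A B : PreStr L) (e : A.M → B.M), Finite A.M → OnePointExt A B e →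
    ∀ φ : A.M → U.M, Emb A U φ →
      ∃ ψ : B.M → U.M, Emb B U ψ ∧ ψ ∘ e = φ

/-- `Δ` is a distance value set. -/
def DistValueSet (Δ : Set ℝ) : Prop :=
  Δ ⊆ Set.Ioi 0 ∧
  ∀ a ∈ Δ, ∀ b ∈ Δ,
    (BddAbove Δ → min (a + b) (sSup Δ) ∈ Δ) ∧ (¬ BddAbove Δ → a + b ∈ Δ)

/-- `(Δ, V)` is a good value pair for `L`. -/
def GoodPair (L : Sig) (Δ V : Set ℝ) : Prop :=
  DistValueSet Δ ∧ V ⊆ Set.Icc 0 1 ∧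
  (BddAbove Δ → ∀ i j, 1 ≤ L.u i j (sSup Δ)) ∧
  (0 : ℝ) ∈ V ∧
  ∀ v ∈ V, ∀ δ ∈ Δ, ∀ i j, L.u i j δ < v → v - L.u i j δ ∈ V

/-- `A` is `(Δ, V)`-valued. -/
def Valued {L : Sig} (Δ V : Set ℝ) (A : PreStr L) : Prop :=
  (∀ x y : A.M, x ≠ y → A.d x y ∈ Δ) ∧ ∀ i x, A.R i x ∈ V

/-- `U` has the `(Δ, V)`-Urysohn property. -/
def HasUrysohnRel {L : Sig} (Δ V : Set ℝ) (U : PreStr L) : Prop :=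
  ∀ (A B : PreStr L) (e : A.M → B.M), Finite A.M →
    Valued Δ V A → Valued Δ V B → OnePointExt A B e →
    ∀ φ : A.M → U.M, Emb A U φ →
      ∃ ψ : B.M → U.M, Emb B U ψ ∧ ψ ∘ e = φ

/-- `f` is an automorphism of `A`. -/
def Aut {L : Sig} (A : PreStr L) (f : A.M → A.M) : Prop :=
  Function.Bijective f ∧ Emb A A f

/-- `f` restricted to `S` is a partial isomorphism of `A`. -/
def PartIso {L : Sig} (A : PreStr L) (S : Set A.M) (f : A.M → A.M) : Prop :=
  Set.InjOn f S ∧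
  (∀ x ∈ S, ∀ y ∈ S, A.d (f x) (f y) = A.d x y) ∧
  ∀ (i : L.I) (x : Fin (L.n i) → A.M), (∀ k, x k ∈ S) → A.R i (f ∘ x) = A.R i x

/-- `act` is an action of the group `Γ` on `A` by automorphisms. -/
def IsActionByAut (L : Sig) (Γ : Type) (gΓ : Group Γ) (A : PreStr L)
    (act : Γ → A.M → A.M) : Prop :=
  letI := gΓ
  (∀ x, act 1 x = x) ∧ (∀ g h x, act (g * h) x = act g (act h x)) ∧
  ∀ g : Γ, Aut A (act g)

/-- `(e, f)` is an embedding from the action `actA : Λ ↷ A` to `actB : Γ ↷ B`. -/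
def ActEmb (L : Sig) (Λ Γ : Type) (gΛ : Group Λ) (gΓ : Group Γ)
    (A B : PreStr L) (actA : Λ → A.M → A.M) (actB : Γ → B.M → B.M)
    (e : Λ → Γ) (f : A.M → B.M) : Prop :=
  letI := gΛ
  letI := gΓ
  Function.Injective e ∧ (∀ g h : Λ, e (g * h) = e g * e h) ∧
  Emb A B f ∧ ∀ (g : Λ) (x : A.M), actB (e g) (f x) = f (actA g x)

/-- A continuous pre-structure on `X` whose distance is only a pseudometric. -/
structure PsStr (L : Sig) (X : Type) where
  d : X → X → ℝ
  d_self : ∀ x, d x x = 0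
  d_comm : ∀ x y, d x y = d y x
  d_triangle : ∀ x y z, d x z ≤ d x y + d y z
  R : (i : L.I) → (Fin (L.n i) → X) → ℝ
  R_mem : ∀ i x, R i x ∈ Set.Icc (0 : ℝ) 1
  R_uc : ∀ (i : L.I) (j : Fin (L.n i)) (x y : Fin (L.n i) → X),
    (∀ k, k ≠ j → x k = y k) → |R i x - R i y| ≤ L.u i j (d (x j) (y j))

namespace PsStr

variable {L : Sig} {X T : Type}

theorem d_nonneg (P : PsStr L X) (x y : X) : 0 ≤ P.d x y := by
  have := P.d_triangle x y x
  rw [P.d_self, P.d_comm y x] at this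
  linarith

theorem d_congr (P : PsStr L X) {x x' y y' : X} (hx : P.d x x' = 0) (hy : P.d y y' = 0) :
    P.d x y = P.d x' y' := by
  have h1 := P.d_triangle x x' y
  have h2 := P.d_triangle x' y' y
  have h3 := P.d_triangle x' x y'
  have h4 := P.d_triangle x y y'
  rw [P.d_comm y' y] at h2
  rw [P.d_comm x' x] at h3
  linarith

theorem abs_R_sub_le (P : PsStr L X) (i : L.I) (x y : Fin (L.n i) → X) :
    |P.R i x - P.R i y| ≤ ∑ k, L.u i k (P.d (x k) (y k)) := by
  classical
  have key : ∀ s : Finset (Fin (L.n i)),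
      |P.R i x - P.R i (s.piecewise y x)| ≤ ∑ k ∈ s, L.u i k (P.d (x k) (y k)) := by
    intro s
    induction s using Finset.induction_on with
    | empty => simp
    | insert a s ha ih =>
      rw [Finset.sum_insert ha]
      have h := P.R_uc i a (s.piecewise y x) ((insert a s).piecewise y x) (by
        intro k hk
        by_cases hks : k ∈ s <;> simp [Finset.piecewise, hk, hks])
      have e1 : s.piecewise y x a = x a := by simp [Finset.piecewise, ha]
      have e2 : (insert a s).piecewise y x a = y a := by simp [Finset.piecewise]
      rw [e1, e2] at h
      have := abs_sub_le (P.R i x) (P.R i (s.piecewise y x)) (P.R i ((insert a s).piecewise y x))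
      linarith
  simpa using key Finset.univ

theorem R_congr (P : PsStr L X) (i : L.I) {x y : Fin (L.n i) → X}
    (h : ∀ k, P.d (x k) (y k) = 0) : P.R i x = P.R i y := by
  have := P.abs_R_sub_le i x y
  simp only [h, L.u_zero, Finset.sum_const_zero] at this
  exact sub_eq_zero.1 (abs_nonpos_iff.1 this)

/-- The pseudo-structure pulled back along a map. -/
def comap (P : PsStr L X) (m : T → X) : PsStr L T where
  d x y := P.d (m x) (m y)
  d_self _ := P.d_self _
  d_comm _ _ := P.d_comm _ _
  d_triangle _ _ _ := P.d_triangle _ _ _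
  R i x := P.R i (m ∘ x)
  R_mem i _ := P.R_mem i _
  R_uc i j x y h := P.R_uc i j (m ∘ x) (m ∘ y) fun k hk => congrArg m (h k hk)

/-- A pseudo-structure whose distance separates points is a pre-structure. -/
def toPreStr (P : PsStr L X) (h : ∀ x y, P.d x y = 0 → x = y) : PreStr L where
  M := X
  d := P.d
  d_self := P.d_self
  d_eq_zero := h
  d_comm := P.d_comm
  d_triangle := P.d_triangle
  R := P.R
  R_mem := P.R_mem
  R_uc := P.R_uc

/-- The supremum of a finite nonempty family of pseudo-structures. -/
noncomputable def sup {K : Type} [Fintype K] [Nonempty K] (P : K → PsStr L X) : PsStr L X where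
  d x y := Finset.univ.sup' Finset.univ_nonempty fun k => (P k).d x y
  d_self _ := (Finset.sup'_congr _ rfl fun k _ => (P k).d_self _).trans (Finset.sup'_const _ 0)
  d_comm x y := Finset.sup'_congr _ rfl fun k _ => (P k).d_comm x y
  d_triangle x y z := by
    refine Finset.sup'_le _ _ fun k _ => ((P k).d_triangle x y z).trans (add_le_add ?_ ?_)
    · exact Finset.le_sup' (fun k => (P k).d x y) (Finset.mem_univ k)
    · exact Finset.le_sup' (fun k => (P k).d y z) (Finset.mem_univ k)
  R i x := Finset.univ.sup' Finset.univ_nonempty fun k => (P k).R i x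
  R_mem i x := by
    obtain ⟨k⟩ := ‹Nonempty K›
    exact ⟨((P k).R_mem i x).1.trans
      (Finset.le_sup' (fun k => (P k).R i x) (Finset.mem_univ k)),
      Finset.sup'_le _ _ fun k _ => ((P k).R_mem i x).2⟩
  R_uc i j := by
    have key : ∀ x y : Fin (L.n i) → X, (∀ k, k ≠ j → x k = y k) →
        (Finset.univ.sup' Finset.univ_nonempty fun k => (P k).R i x) ≤
        (Finset.univ.sup' Finset.univ_nonempty fun k => (P k).R i y) +
          L.u i j (Finset.univ.sup' Finset.univ_nonempty fun k => (P k).d (x j) (y j)) := by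
      intro x y h
      refine Finset.sup'_le _ _ fun k _ => ?_
      have h1 := (abs_le.1 ((P k).R_uc i j x y h)).2
      have h2 : (P k).R i y ≤ _ := Finset.le_sup' (fun k => (P k).R i y) (Finset.mem_univ k)
      have h3 : (P k).d (x j) (y j) ≤ _ := Finset.le_sup' (fun k => (P k).d (x j) (y j)) (Finset.mem_univ k)
      have h4 := L.u_mono i j ((P k).d_nonneg (x j) (y j))
        (((P k).d_nonneg (x j) (y j)).trans h3) h3
      linarith
    intro x y h
    have h1 := key x y h
    have h2 := key y x fun k hk => (h k hk).symm
    rw [Finset.sup'_congr _ rfl fun k _ => (P k).d_comm (y j) (x j)] at h2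
    exact abs_le.2 ⟨by linarith, by linarith⟩

section sup

variable {K : Type} [Fintype K] [Nonempty K] {P : K → PsStr L X}

theorem sup_d_le {x y : X} {a : ℝ} (h : ∀ k, (P k).d x y ≤ a) : (sup P).d x y ≤ a :=
  Finset.sup'_le Finset.univ_nonempty _ fun k _ => h k

theorem le_sup_d (k : K) (x y : X) : (P k).d x y ≤ (sup P).d x y :=
  Finset.le_sup' (fun k => (P k).d x y) (Finset.mem_univ k)

theorem sup_R_le {i : L.I} {x : Fin (L.n i) → X} {a : ℝ} (h : ∀ k, (P k).R i x ≤ a) :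
    (sup P).R i x ≤ a :=
  Finset.sup'_le Finset.univ_nonempty _ fun k _ => h k

theorem le_sup_R (k : K) (i : L.I) (x : Fin (L.n i) → X) : (P k).R i x ≤ (sup P).R i x :=
  Finset.le_sup' (fun k => (P k).R i x) (Finset.mem_univ k)

end sup

/-- The pseudo-structure with vanishing relations whose distance is the discrete distance
between the classes of a labelling. -/
noncomputable def discrete (L : Sig) {Y : Type} (c : X → Y) : PsStr L X where
  d x y := open Classical in if c x = c y then 0 else 1
  d_self x := by simp
  d_comm x y := by split_ifs <;> grind
  d_triangle x y z := by
    split_ifs <;> grind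
  R _ _ := 0
  R_mem _ _ := by simp
  R_uc i j x y _ := by simpa using L.u_nonneg i j _

theorem discrete_d_congr {Y : Type} {c : X → Y} {x y x' y' : X}
    (h : c x = c y ↔ c x' = c y') : (discrete L c).d x y = (discrete L c).d x' y' := by
  classical exact if_congr h rfl rfl

end PsStr

/-- A pre-structure seen as a pseudo-structure. -/
def PreStr.toPsStr {L : Sig} (U : PreStr L) : PsStr L U.M where
  d := U.d
  d_self := U.d_self
  d_comm := U.d_comm
  d_triangle := U.d_triangle
  R := U.R
  R_mem := U.R_mem
  R_uc := U.R_uc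

theorem PreStr.d_nonneg {L : Sig} (U : PreStr L) (x y : U.M) : 0 ≤ U.d x y :=
  U.toPsStr.d_nonneg x y

/-- Collapse `U × {0}` in `U × εℕ` to a point and pull the resulting pseudo-structure back along
`x ↦ (π x, ε * m x)`; the relations are cut off near the collapsed point. -/
noncomputable def cone {L : Sig} {X : Type} (U : PreStr L) (π : X → U.M) (m : X → ℕ) (ε η : ℝ)
    (hε : 0 ≤ ε) (hη : 0 ≤ η)
    (H : ∀ i j (n : ℕ), 1 ≤ L.u i j (ε * n) ∨ η * n ≤ L.u i j (ε * n)) : PsStr L X where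
  d x y := min (U.d (π x) (π y) + |ε * m x - ε * m y|) (ε * m x + ε * m y)
  d_self x := by
    have : 0 ≤ ε * m x := by positivity
    simp only [U.d_self, sub_self, abs_zero, add_zero]
    exact min_eq_left (by linarith)
  d_comm x y := by rw [U.d_comm, abs_sub_comm, add_comm (ε * m x)]
  d_triangle x y z := by
    have hx : 0 ≤ ε * m x := by positivity
    have hy : 0 ≤ ε * m y := by positivity
    have hz : 0 ≤ ε * m z := by positivity
    have h1 := U.d_triangle (π x) (π y) (π z)
    have h2 := abs_sub_le (ε * m x) (ε * m y) (ε * m z)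
    have h3 := abs_le.1 (le_refl |ε * m x - ε * m y|)
    have h4 := abs_le.1 (le_refl |ε * m y - ε * m z|)
    have h5 := U.d_nonneg (π x) (π y)
    have h6 := U.d_nonneg (π y) (π z)
    rcases min_choice (U.d (π x) (π y) + |ε * m x - ε * m y|) (ε * m x + ε * m y) with a | a <;>
    rcases min_choice (U.d (π y) (π z) + |ε * m y - ε * m z|) (ε * m y + ε * m z) with b | b <;>
    rw [a, b]
    · exact (min_le_left _ _).trans (by linarith)
    all_goals exact (min_le_right _ _).trans (by linarith)
  R i x := min (U.R i (π ∘ x))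
    (Finset.univ.inf' ⟨⟨0, L.n_pos i⟩, Finset.mem_univ _⟩ fun j => η * m (x j))
  R_mem i x := by
    refine ⟨le_min (U.R_mem i _).1 ?_, (min_le_left _ _).trans (U.R_mem i _).2⟩
    exact Finset.le_inf' _ _ fun j _ => by positivity
  R_uc i j := by
    set Rc : (Fin (L.n i) → X) → ℝ := fun x => min (U.R i (π ∘ x))
      (Finset.univ.inf' ⟨⟨0, L.n_pos i⟩, Finset.mem_univ _⟩ fun j => η * m (x j)) with hRc
    set dc : X → X → ℝ := fun x y =>
      min (U.d (π x) (π y) + |ε * m x - ε * m y|) (ε * m x + ε * m y) with hdc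
    have le1 : ∀ x, Rc x ≤ U.R i (π ∘ x) := fun x => min_le_left _ _
    have le2 : ∀ x k, Rc x ≤ η * m (x k) := fun x k =>
      (min_le_right _ _).trans (Finset.inf'_le _ (Finset.mem_univ k))
    have ge0 : ∀ x, 0 ≤ Rc x := fun x =>
      le_min (U.R_mem i _).1 (Finset.le_inf' _ _ fun j _ => by positivity)
    have mono : ∀ {r s : ℝ}, 0 ≤ r → r ≤ s → L.u i j r ≤ L.u i j s := fun hr hs =>
      L.u_mono i j hr (hr.trans hs) hs
    have key : ∀ x y : Fin (L.n i) → X, (∀ k, k ≠ j → x k = y k) →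
        Rc x ≤ Rc y + L.u i j (dc (x j) (y j)) := by
      intro x y h
      have u0 := L.u_nonneg i j (dc (x j) (y j))
      by_cases hu : 1 ≤ L.u i j (dc (x j) (y j))
      · have := le1 x
        have := (U.R_mem i (π ∘ x)).2
        linarith [ge0 y]
      have hx : 0 ≤ ε * m (x j) := by positivity
      have hy : 0 ≤ ε * m (y j) := by positivity
      rcases min_choice (U.d (π (x j)) (π (y j)) + |ε * m (x j) - ε * m (y j)|)
        (ε * m (x j) + ε * m (y j)) with a | a
      · have hd : dc (x j) (y j) = _ := a
        have hdn := U.d_nonneg (π (x j)) (π (y j))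
        have hab := abs_nonneg (ε * m (x j) - ε * m (y j))
        rw [← sub_le_iff_le_add]
        refine le_min ?_ (Finset.le_inf' _ _ fun k _ => ?_)
        · have h1 := (abs_le.1 (U.R_uc i j (π ∘ x) (π ∘ y)
            fun k hk => congrArg π (h k hk))).2
          have h2 : L.u i j (U.d (π (x j)) (π (y j))) ≤ L.u i j (dc (x j) (y j)) :=
            mono hdn (by rw [hd]; linarith)
          have := le1 x
          simp only [Function.comp_apply] at h1
          linarith
        · by_cases hk : k = j
          · subst hk
            have := le2 x k
            rcases le_total (m (x k)) (m (y k)) with hm | hm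
            · have : η * (m (x k) : ℝ) ≤ η * m (y k) := by gcongr
              linarith
            · have e : |ε * m (x k) - ε * m (y k)| = ε * ((m (x k) - m (y k) : ℕ) : ℝ) := by
                rw [Nat.cast_sub hm, ← mul_sub, abs_of_nonneg]
                exact mul_nonneg hε (sub_nonneg.2 (Nat.cast_le.2 hm))
              have h2 : L.u i k (ε * ((m (x k) - m (y k) : ℕ) : ℝ)) ≤ L.u i k (dc (x k) (y k)) :=
                mono (by positivity) (by rw [hd, ← e]; linarith)
              rcases H i k (m (x k) - m (y k)) with h3 | h3
              · exact absurd (h3.trans h2) hu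
              · rw [Nat.cast_sub hm] at h3 h2
                linarith
          · have := le2 x k
            rw [h k hk] at this
            linarith
      · have hd : dc (x j) (y j) = _ := a
        have h2 : L.u i j (ε * m (x j)) ≤ L.u i j (dc (x j) (y j)) :=
          mono hx (by rw [hd]; linarith)
        rcases H i j (m (x j)) with h3 | h3
        · exact absurd (h3.trans h2) hu
        · linarith [le2 x j, ge0 y]
    intro x y h
    have h1 := key x y h
    have h2 := key y x fun k hk => (h k hk).symm
    have h3 : dc (y j) (x j) = dc (x j) (y j) := by
      simp only [hdc]
      rw [U.d_comm, abs_sub_comm, add_comm (ε * m (y j))]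
    rw [h3] at h2
    exact abs_le.2 ⟨by linarith, by linarith⟩

/-- `j` preserves distances and relations. -/
def Pres {L : Sig} {X : Type} (P : PsStr L X) (U : PreStr L) (j : X → U.M) : Prop :=
  (∀ x y, U.d (j x) (j y) = P.d x y) ∧ ∀ i x, U.R i (j ∘ x) = P.R i x

/-- `j` preserves distances and relations on `S`. -/
def PresOn {L : Sig} {X : Type} (P : PsStr L X) (U : PreStr L) (S : Set X) (j : X → U.M) : Prop :=
  (∀ x ∈ S, ∀ y ∈ S, U.d (j x) (j y) = P.d x y) ∧
  ∀ i x, (∀ k, x k ∈ S) → U.R i (j ∘ x) = P.R i x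

section Realization

variable {L : Sig} {U : PreStr L} {X T : Type}

theorem exists_pres_option (hU : HasUrysohn U) [Finite T] (P : PsStr L (Option T))
    (j : T → U.M) (hj : Pres (P.comap some) U j) :
    ∃ y, Pres P U fun o => o.elim y j := by
  by_cases hz : ∃ t, P.d none (some t) = 0
  · obtain ⟨t, ht⟩ := hz
    set r : Option T → T := fun o => o.elim t id
    have hr : ∀ o, P.d o (some (r o)) = 0 := by
      rintro (_ | s)
      · exact ht
      · exact P.d_self _
    have e : (fun o : Option T => o.elim (j t) j) = j ∘ r := by
      funext o
      cases o <;> rfl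
    refine ⟨j t, ?_⟩
    rw [e]
    exact ⟨fun x y => (hj.1 _ _).trans (P.d_congr (hr x) (hr y)).symm,
      fun i x => (hj.2 i (r ∘ x)).trans (P.R_congr i fun k => hr (x k)).symm⟩
  · push Not at hz
    choose r hr using fun b : Set.range j => b.2
    have hpos : ∀ a b : Option (Set.range j), P.d (a.map r) (b.map r) = 0 → a = b := by
      rintro (_ | a) (_ | b) h
      · rfl
      · exact absurd h (hz _)
      · rw [P.d_comm] at h
        exact absurd h (hz _)
      · have := (hj.1 (r a) (r b)).trans h
        rw [hr, hr] at this
        exact congrArg some (Subtype.ext (U.d_eq_zero _ _ this))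
    let B := (P.comap fun a : Option (Set.range j) => a.map r).toPreStr hpos
    let A := (P.comap fun a : Set.range j => some (r a)).toPreStr
      fun a b h => Option.some_injective _ (hpos (some a) (some b) h)
    obtain ⟨ψ, hψ, hψe⟩ := hU A B some (Set.finite_range j)
      ⟨⟨Option.some_injective _, fun _ _ => rfl, fun _ _ => rfl⟩, none,
        by rintro ⟨a, ha⟩; exact Option.some_ne_none a ha,
        by rintro (_ | a)
           · exact Or.inr rfl
           · exact Or.inl ⟨a, rfl⟩⟩
      (fun a => a.1) ⟨Subtype.val_injective, fun a b => by
        refine Eq.trans ?_ (hj.1 (r a) (r b))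
        rw [hr a, hr b], fun i x => by
        refine Eq.trans ?_ (hj.2 i (r ∘ x))
        congr 1
        funext k
        exact (hr (x k)).symm⟩
    let z : Option T → Option (Set.range j) := Option.map fun t => ⟨j t, t, rfl⟩
    have hzd : ∀ o, P.d o ((z o).map r) = 0 := by
      rintro (_ | t)
      · exact P.d_self _
      · refine (hj.1 _ _).symm.trans ?_
        rw [hr]
        exact U.d_self _
    have e : (fun o : Option T => o.elim (ψ none) j) = ψ ∘ z := by
      funext o
      cases o with
      | none => rfl
      | some t => exact (congrFun hψe ⟨j t, t, rfl⟩).symm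
    refine ⟨ψ none, ?_⟩
    rw [e]
    exact ⟨fun x y => (hψ.2.1 _ _).trans (P.d_congr (hzd x) (hzd y)).symm,
      fun i x => (hψ.2.2 i (z ∘ x)).trans (P.R_congr i fun k => hzd (x k)).symm⟩

theorem PresOn.exists_insert (hU : HasUrysohn U) (P : PsStr L X) {S : Set X} (hS : S.Finite)
    {j : X → U.M} (hj : PresOn P U S j) (x : X) :
    ∃ j', PresOn P U (insert x S) j' ∧ Set.EqOn j' j S := by
  classical
  have := hS.to_subtype
  let m : Option S → X := fun o => o.elim x Subtype.val
  obtain ⟨y, hy⟩ := exists_pres_option hU (P.comap m) (fun s : S => j s)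
    ⟨fun a b => hj.1 a a.2 b b.2, fun i a => hj.2 i (fun k => a k) fun k => (a k).2⟩
  let l : X → Option S := fun z => if h : z ∈ S then some ⟨z, h⟩ else none
  have hl : ∀ z ∈ insert x S, m (l z) = z := by
    rintro z hz
    by_cases h : z ∈ S
    · simp [l, m, h]
    · simp only [l, m, h, dite_false]
      exact (hz.resolve_right h).symm
  refine ⟨fun z => (l z).elim y fun s : S => j s, ⟨fun a ha b hb => ?_, fun i a ha => ?_⟩, ?_⟩
  · refine (hy.1 (l a) (l b)).trans ?_
    simp only [PsStr.comap, hl a ha, hl b hb]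
  · refine (hy.2 i (l ∘ a)).trans ?_
    simp only [PsStr.comap]
    congr 1
    funext k
    exact hl _ (ha k)
  · intro z hz
    simp [l, hz]

theorem PresOn.exists_union (hU : HasUrysohn U) (P : PsStr L X) {S₀ S : Set X} (hS₀ : S₀.Finite)
    (hS : S.Finite) {j : X → U.M} (hj : PresOn P U S₀ j) :
    ∃ j', PresOn P U (S ∪ S₀) j' ∧ Set.EqOn j' j S₀ := by
  induction S, hS using Set.Finite.induction_on with
  | empty => exact ⟨j, by simpa using hj, fun _ _ => rfl⟩
  | @insert a S _ hS ih =>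
    obtain ⟨j₁, h₁, e₁⟩ := ih
    obtain ⟨j₂, h₂, e₂⟩ := h₁.exists_insert hU P (hS.union hS₀) a
    exact ⟨j₂, by rwa [Set.insert_union],
      fun z hz => (e₂ (Or.inr hz)).trans (e₁ hz)⟩

theorem HasUrysohn.nonempty (hU : HasUrysohn U) : Nonempty U.M :=
  let P : PsStr L (Option Empty) := PsStr.discrete L id
  ⟨(exists_pres_option hU P Empty.elim ⟨fun x => x.elim, fun i x => (x ⟨0, L.n_pos i⟩).elim⟩).choose⟩

end Realization

section Homogeneity

variable {L : Sig} {U : PreStr L}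

/-- `S` is the graph of a relation preserving distances and relations. -/
def Good (U : PreStr L) (S : Set (U.M × U.M)) : Prop :=
  (∀ p ∈ S, ∀ q ∈ S, U.d p.1 q.1 = U.d p.2 q.2) ∧
  ∀ i (x : Fin (L.n i) → U.M × U.M), (∀ k, x k ∈ S) →
    U.R i (fun k => (x k).1) = U.R i (fun k => (x k).2)

theorem Good.swap {S : Set (U.M × U.M)} (h : Good U S) : Good U (Prod.swap ⁻¹' S) :=
  ⟨fun _ hp _ hq => (h.1 _ hp _ hq).symm, fun i x hx => (h.2 i (fun k => (x k).swap) hx).symm⟩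

theorem Good.exists_insert (hU : HasUrysohn U) {S : Set (U.M × U.M)} (hS : S.Finite)
    (h : Good U S) (x : U.M) : ∃ y, Good U (insert (x, y) S) := by
  classical
  have := hS.to_subtype
  let m : Option S → U.M := fun o => o.elim x fun p => p.1.1
  obtain ⟨y, hy⟩ := exists_pres_option hU (U.toPsStr.comap m) (fun p : S => p.1.2)
    ⟨fun a b => (h.1 a a.2 b b.2).symm, fun i a => (h.2 i (fun k => a k) fun k => (a k).2).symm⟩
  let l : U.M × U.M → Option S := fun z => if h : z ∈ S then some ⟨z, h⟩ else none
  have hl : ∀ z ∈ insert (x, y) S, m (l z) = z.1 ∧ (l z).elim y (fun p : S => p.1.2) = z.2 := by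
    rintro z hz
    by_cases h : z ∈ S
    · simp [l, m, h]
    · simp only [l, m, h, dite_false]
      rw [hz.resolve_right h]
      exact ⟨rfl, rfl⟩
  refine ⟨y, fun p hp q hq => ?_, fun i a ha => ?_⟩
  · have := hy.1 (l p) (l q)
    simp only [PsStr.comap, PreStr.toPsStr, hl p hp, hl q hq] at this
    exact this.symm
  · have := hy.2 i (l ∘ a)
    simp only [PsStr.comap, PreStr.toPsStr] at this
    convert this.symm using 2
    · funext k
      exact (hl _ (ha k)).1.symm
    · funext k
      exact (hl _ (ha k)).2.symm

theorem Good.exists_insert_insert (hU : HasUrysohn U) {S : Set (U.M × U.M)} (hS : S.Finite)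
    (h : Good U S) (x : U.M) :
    ∃ S' : Set (U.M × U.M), S'.Finite ∧ Good U S' ∧ S ⊆ S' ∧ (∃ y, (x, y) ∈ S') ∧
      ∃ y, (y, x) ∈ S' := by
  obtain ⟨y, hy⟩ := h.exists_insert hU hS x
  have hf : (Prod.swap ⁻¹' (insert (x, y) S)).Finite :=
    (hS.insert _).preimage Prod.swap_injective.injOn
  obtain ⟨z, hz⟩ := hy.swap.exists_insert hU hf x
  refine ⟨_, (hf.insert (x, z)).preimage Prod.swap_injective.injOn, hz.swap, ?_, ⟨y, ?_⟩, z, ?_⟩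
  · intro p hp
    right
    simp [hp]
  · right
    simp
  · left
    rfl

theorem Good.iUnion {S : ℕ → Set (U.M × U.M)} (hm : Monotone S) (h : ∀ n, Good U (S n)) :
    Good U (⋃ n, S n) := by
  refine ⟨fun p hp q hq => ?_, fun i x hx => ?_⟩
  · obtain ⟨a, ha⟩ := Set.mem_iUnion.1 hp
    obtain ⟨b, hb⟩ := Set.mem_iUnion.1 hq
    exact (h (max a b)).1 _ (hm (le_max_left a b) ha) _ (hm (le_max_right a b) hb)
  · choose a ha using fun k => Set.mem_iUnion.1 (hx k)
    exact (h (Finset.univ.sup a)).2 i x fun k => hm (Finset.le_sup (Finset.mem_univ k)) (ha k)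

theorem PreStr.exists_forall_abs_R_sub_lt (U : PreStr L) (i : L.I) {ε : ℝ} (hε : 0 < ε) :
    ∃ δ > 0, ∀ x y : Fin (L.n i) → U.M, (∀ k, U.d (x k) (y k) < δ) →
      |U.R i x - U.R i y| < ε := by
  have hlim : Filter.Tendsto (fun δ : ℝ => ∑ k, L.u i k δ) (nhdsWithin 0 (Set.Ioi 0)) (nhds 0) := by
    simpa using tendsto_finsetSum Finset.univ fun k _ => L.u_lim i k
  obtain ⟨δ, h1, h2⟩ := ((hlim.eventually (gt_mem_nhds hε)).and self_mem_nhdsWithin).exists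
  refine ⟨δ, h2, fun x y h => (U.toPsStr.abs_R_sub_le i x y).trans_lt (lt_of_le_of_lt ?_ h1)⟩
  exact Finset.sum_le_sum fun k _ => L.u_mono i k (U.d_nonneg _ _) (le_of_lt h2) (h k).le

theorem PreStr.abs_d_sub_le (U : PreStr L) (a b x y : U.M) :
    |U.d a b - U.d x y| ≤ U.d a x + U.d b y := by
  have h1 := U.d_triangle a x b
  have h2 := U.d_triangle x y b
  have h3 := U.d_triangle x a y
  have h4 := U.d_triangle a b y
  rw [U.d_comm y b] at h2
  rw [U.d_comm x a] at h3
  exact abs_le.2 ⟨by linarith, by linarith⟩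

/-- The closure of a binary relation on `U`. -/
def PreStr.clos (U : PreStr L) (S : Set (U.M × U.M)) : Set (U.M × U.M) :=
  {p | ∀ ε > 0, ∃ q ∈ S, U.d p.1 q.1 < ε ∧ U.d p.2 q.2 < ε}

theorem PreStr.subset_clos (U : PreStr L) (S : Set (U.M × U.M)) : S ⊆ U.clos S :=
  fun p hp ε hε => ⟨p, hp, by rwa [U.d_self], by rwa [U.d_self]⟩

theorem Good.clos {S : Set (U.M × U.M)} (h : Good U S) : Good U (U.clos S) := by
  have key : ∀ a b : ℝ, (∀ ε > 0, |a - b| ≤ ε) → a = b := fun a b hab =>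
    sub_eq_zero.1 (abs_nonpos_iff.1 (le_of_forall_pos_le_add fun ε hε => by
      simpa using hab ε hε))
  refine ⟨fun p hp q hq => key _ _ fun ε hε => ?_, fun i x hx => key _ _ fun ε hε => ?_⟩
  · obtain ⟨p', hp', h1, h2⟩ := hp (ε / 4) (by positivity)
    obtain ⟨q', hq', h3, h4⟩ := hq (ε / 4) (by positivity)
    have h5 := abs_le.1 (U.abs_d_sub_le p.1 q.1 p'.1 q'.1)
    have h6 := abs_le.1 (U.abs_d_sub_le p.2 q.2 p'.2 q'.2)
    have h7 := h.1 p' hp' q' hq'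
    exact abs_le.2 ⟨by linarith, by linarith⟩
  · obtain ⟨δ, hδ, hR⟩ := U.exists_forall_abs_R_sub_lt i (half_pos hε)
    choose q hq h1 h2 using fun k => hx k δ hδ
    have h3 := abs_lt.1 (hR _ _ h1)
    have h4 := abs_lt.1 (hR _ _ h2)
    have h5 := h.2 i q hq
    exact abs_le.2 ⟨by linarith, by linarith⟩

theorem Good.exists_mem_clos (hc : U.IsComplete) {S : Set (U.M × U.M)} (h : Good U S)
    (hd : ∀ x, ∀ ε > 0, ∃ p ∈ S, U.d x p.1 < ε) (x : U.M) : ∃ y, (x, y) ∈ U.clos S := by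
  choose p hp hx using fun n : ℕ => hd x (1 / ((n : ℝ) + 1)) (by positivity)
  have hsmall : ∀ ε > 0, ∃ N : ℕ, ∀ n ≥ N, U.d x (p n).1 < ε := by
    intro ε hε
    obtain ⟨N, hN⟩ := exists_nat_one_div_lt hε
    refine ⟨N, fun n hn => (hx n).trans (lt_of_le_of_lt ?_ hN)⟩
    gcongr
  obtain ⟨y, hy⟩ := hc (fun n => (p n).2) fun ε hε => by
    obtain ⟨N, hN⟩ := hsmall (ε / 2) (half_pos hε)
    refine ⟨N, fun m hm n hn => ?_⟩
    have h1 := h.1 _ (hp m) _ (hp n)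
    have h2 := U.d_triangle (p m).1 x (p n).1
    rw [U.d_comm _ x] at h2
    linarith [hN m hm, hN n hn]
  refine ⟨y, fun ε hε => ?_⟩
  obtain ⟨N, hN⟩ := hsmall ε hε
  obtain ⟨N', hN'⟩ := hy ε hε
  exact ⟨p (max N N'), hp _, hN _ (le_max_left _ _), by
    rw [U.d_comm]
    exact hN' _ (le_max_right _ _)⟩

theorem Good.exists_aut (hc : U.IsComplete) {S : Set (U.M × U.M)} (h : Good U S)
    (hd₁ : ∀ x, ∀ ε > 0, ∃ p ∈ S, U.d x p.1 < ε) (hd₂ : ∀ x, ∀ ε > 0, ∃ p ∈ S, U.d x p.2 < ε) :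
    ∃ f : Equiv.Perm U.M, Aut U f ∧ ∀ p ∈ S, f p.1 = p.2 := by
  choose f hf using h.exists_mem_clos hc hd₁
  choose g hg using h.swap.exists_mem_clos hc fun x ε hε => by
    obtain ⟨p, hp, hx⟩ := hd₂ x ε hε
    exact ⟨p.swap, by simpa using hp, hx⟩
  have hg' : ∀ y, (g y, y) ∈ U.clos S := fun y ε hε => by
    obtain ⟨p, hp, h1, h2⟩ := hg y ε hε
    exact ⟨p.swap, hp, h2, h1⟩
  have hG := h.clos
  have uniq₂ : ∀ {x y y'}, (x, y) ∈ U.clos S → (x, y') ∈ U.clos S → y = y' := fun hy hy' =>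
    U.d_eq_zero _ _ ((hG.1 _ hy _ hy').symm.trans (U.d_self _))
  have uniq₁ : ∀ {x x' y}, (x, y) ∈ U.clos S → (x', y) ∈ U.clos S → x = x' := fun hy hy' =>
    U.d_eq_zero _ _ ((hG.1 _ hy _ hy').trans (U.d_self _))
  let F : Equiv.Perm U.M := ⟨f, g, fun x => uniq₁ (hg' _) (hf _), fun y => uniq₂ (hf _) (hg' _)⟩
  exact ⟨F, ⟨F.bijective, F.injective, fun x y => (hG.1 _ (hf x) _ (hf y)).symm,
    fun i x => (hG.2 i (fun k => (x k, f (x k))) fun k => hf _).symm⟩,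
    fun p hp => uniq₂ (hf _) (U.subset_clos S hp)⟩

theorem Good.exists_aut_of_finite (hU : HasUrysohn U) (hc : U.IsComplete) {D : ℕ → U.M}
    (hD : ∀ x, ∀ ε > 0, ∃ n, U.d x (D n) < ε) {S : Set (U.M × U.M)} (hS : S.Finite)
    (h : Good U S) : ∃ f : Equiv.Perm U.M, Aut U f ∧ ∀ p ∈ S, f p.1 = p.2 := by
  choose nx hfin hgood hsub h₁ h₂ using
    fun (T : {T : Set (U.M × U.M) // T.Finite ∧ Good U T}) (x : U.M) =>
      T.2.2.exists_insert_insert hU T.2.1 x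
  let C : ℕ → {T : Set (U.M × U.M) // T.Finite ∧ Good U T} := fun n =>
    Nat.rec ⟨S, hS, h⟩ (fun n T => ⟨nx T (D n), hfin T _, hgood T _⟩) n
  have hm : Monotone fun n => (C n).1 := monotone_nat_of_le_succ fun n => hsub (C n) (D n)
  obtain ⟨f, hf, hfS⟩ := (Good.iUnion hm fun n => (C n).2.2).exists_aut hc
    (fun x ε hε => by
      obtain ⟨n, hn⟩ := hD x ε hε
      obtain ⟨y, hy⟩ := h₁ (C n) (D n)
      exact ⟨_, Set.mem_iUnion.2 ⟨n + 1, hy⟩, hn⟩)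
    (fun x ε hε => by
      obtain ⟨n, hn⟩ := hD x ε hε
      obtain ⟨y, hy⟩ := h₂ (C n) (D n)
      exact ⟨_, Set.mem_iUnion.2 ⟨n + 1, hy⟩, hn⟩)
  exact ⟨f, hf, fun p hp => hfS p (Set.mem_iUnion.2 ⟨0, hp⟩)⟩

end Homogeneity

section Groups

/-- Right translations of a group by finitely many elements, cut off to permutations of a large
ball for the word length. -/
theorem exists_finite_ball {H ι : Type} [Group H] [Finite ι] (h : ι → H) (N : ℕ) :
    ∃ (C : Type) (_ : Finite C) (c₀ : C) (q : C → H) (len : C → ℕ) (τ : ι → Equiv.Perm C),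
      len c₀ = 0 ∧ ∀ a c, len (τ a c) ≤ len c + 1 ∧ len c ≤ len (τ a c) + 1 ∧
        (len c < N → q (τ a c) = q c * h a) := by
  classical
  obtain ⟨B, hB₀, hB⟩ : ∃ B : ℕ → Set H, B 0 = {1} ∧ ∀ n, B (n + 1) =
      B n ∪ ((⋃ a, (fun x => x * h a) '' B n) ∪ ⋃ a, (fun x => x * (h a)⁻¹) '' B n) :=
    ⟨fun n => Nat.rec {1} (fun _ S =>
      S ∪ ((⋃ a, (fun x => x * h a) '' S) ∪ ⋃ a, (fun x => x * (h a)⁻¹) '' S)) n, rfl, fun _ => rfl⟩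
  have hfin : ∀ n, (B n).Finite := by
    intro n
    induction n with
    | zero => exact hB₀ ▸ Set.finite_singleton 1
    | succ n ih =>
      rw [hB]
      exact ih.union ((Set.finite_iUnion fun a => ih.image _).union
        (Set.finite_iUnion fun a => ih.image _))
  have hmono : Monotone B := monotone_nat_of_le_succ fun n => by
    rw [hB]
    exact Set.subset_union_left
  have hmul : ∀ {n x} a, x ∈ B n → x * h a ∈ B (n + 1) := fun a hx => by
    rw [hB]
    exact Or.inr (Or.inl (Set.mem_iUnion.2 ⟨a, _, hx, rfl⟩))
  have hinv : ∀ {n x} a, x ∈ B n → x * (h a)⁻¹ ∈ B (n + 1) := fun a hx => by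
    rw [hB]
    exact Or.inr (Or.inr (Set.mem_iUnion.2 ⟨a, _, hx, rfl⟩))
  have one_mem : (1 : H) ∈ B 0 := by
    rw [hB₀]
    rfl
  have := (hfin N).to_subtype
  have := Fintype.ofFinite (B N)
  let len : B N → ℕ := fun c => Nat.find (⟨N, c.2⟩ : ∃ n, (c : H) ∈ B n)
  have len_mem : ∀ c, (c : H) ∈ B (len c) := fun c => Nat.find_spec (⟨N, c.2⟩ : ∃ n, (c : H) ∈ B n)
  have len_le : ∀ {c : B N} {n}, (c : H) ∈ B n → len c ≤ n := fun {c n} hc => Nat.find_min' _ hc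
  have len_N : ∀ c, len c ≤ N := fun c => len_le c.2
  let e : ∀ a, {c : B N // (c : H) * h a ∈ B N} ≃ {c : B N // (c : H) * (h a)⁻¹ ∈ B N} := fun a =>
    { toFun := fun c => ⟨⟨c.1 * h a, c.2⟩, by simp⟩
      invFun := fun c => ⟨⟨c.1 * (h a)⁻¹, c.2⟩, by simp⟩
      left_inv := fun c => by simp
      right_inv := fun c => by simp }
  refine ⟨B N, inferInstance, ⟨1, hmono (Nat.zero_le N) one_mem⟩, Subtype.val, len,
    fun a => (e a).extendSubtype, Nat.le_zero.1 (len_le one_mem), fun a c => ?_⟩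
  have hN : ∀ {d : B N} {x : H}, (len d < N → x ∈ B N) → x ∉ B N → len d = N := fun {d x} h1 h2 =>
    (len_N d).antisymm (not_lt.1 fun h => h2 (h1 h))
  by_cases hc : (c : H) * h a ∈ B N
  · have hτ : (((e a).extendSubtype c : B N) : H) = c * h a :=
      congrArg Subtype.val ((e a).extendSubtype_apply_of_mem c hc)
    refine ⟨len_le ?_, len_le ?_, fun _ => hτ⟩
    · rw [hτ]
      exact hmul a (len_mem c)
    · have := hinv a (len_mem ((e a).extendSubtype c))
      rwa [hτ, mul_inv_cancel_right] at this
  · have h1 : len c = N := hN (fun h => hmono h (hmul a (len_mem c))) hc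
    have h2 : len ((e a).extendSubtype c) = N :=
      hN (fun h => hmono h (hinv a (len_mem _))) ((e a).extendSubtype_not_mem c hc)
    exact ⟨(h2.trans h1.symm).le.trans (Nat.le_succ _),
      (h1.trans h2.symm).le.trans (Nat.le_succ _), fun h => absurd h1 h.ne⟩

/-- The regular representations of two isomorphic subgroups of a finite group are conjugate. -/
theorem exists_perm_mul_eq {Γ : Type} [Group Γ] [Finite Γ] {H K : Subgroup Γ} (θ : H ≃* K) :
    ∃ c : Equiv.Perm Γ, ∀ (γ : Γ) (h : H), c (γ * h) = c γ * θ h := by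
  have hcard : Nat.card (Γ ⧸ H) = Nat.card (Γ ⧸ K) := by
    have h1 := H.card_eq_card_quotient_mul_card_subgroup
    have h2 := K.card_eq_card_quotient_mul_card_subgroup
    rw [Nat.card_congr θ.toEquiv, h2] at h1
    exact (Nat.eq_of_mul_eq_mul_right Nat.card_pos h1).symm
  obtain ⟨b⟩ : Nonempty (Γ ⧸ H ≃ Γ ⧸ K) := Finite.card_eq.1 hcard
  let r : Γ → H := fun γ => ⟨(γ : Γ ⧸ H).out⁻¹ * γ, QuotientGroup.eq.1 (QuotientGroup.out_eq' _)⟩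
  let c : Γ → Γ := fun γ => (b γ).out * θ (r γ)
  have hc : ∀ γ, (c γ : Γ ⧸ K) = b γ := fun γ => by
    simp only [c]
    rw [QuotientGroup.mk_mul_of_mem _ (θ (r γ)).2, QuotientGroup.out_eq']
  have hinj : Function.Injective c := by
    intro x y hxy
    have h1 : (x : Γ ⧸ H) = y := b.injective (by rw [← hc, ← hc, hxy])
    have h2 : r x = r y := θ.injective (Subtype.ext (mul_left_cancel (a := (b x).out) (by
      simpa only [c, ← h1] using hxy)))
    have h3 := congrArg Subtype.val h2
    simp only [r, h1] at h3
    exact mul_left_cancel h3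
  refine ⟨Equiv.ofBijective c (Finite.injective_iff_bijective.1 hinj), fun γ h => ?_⟩
  have h1 : ((γ * h : Γ) : Γ ⧸ H) = γ := QuotientGroup.mk_mul_of_mem _ h.2
  have h2 : r (γ * h) = r γ * h := Subtype.ext (by simp [r, h1, mul_assoc])
  simp only [Equiv.ofBijective_apply, c, h1, h2, map_mul, Subgroup.coe_mul, mul_assoc]

theorem exists_injective_hom_perm {Δ Y : Type} [Group Δ] [Finite Δ] [Finite Y]
    (h : Nat.card Δ ≤ Nat.card Y) : ∃ e : Δ →* Equiv.Perm Y, Function.Injective e := by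
  classical
  have := Fintype.ofFinite Δ
  have := Fintype.ofFinite Y
  obtain ⟨f⟩ := Function.Embedding.nonempty_of_card_le
    (by simpa only [Nat.card_eq_fintype_card] using h : Fintype.card Δ ≤ Fintype.card Y)
  exact ⟨(Equiv.Perm.viaEmbeddingHom f).comp (MulAction.toPermHom Δ Δ),
    (Equiv.Perm.viaEmbeddingHom_injective f).comp MulAction.toPerm_injective⟩

/-- A finite group `Γ` containing `Λ` and an element `t`, together with maps to `H` and `Λ` reading off
the value of a word in `Λ` and `t` (with `t` acting as `f`) as long as its length is below `N`. -/
theorem exists_finite_model {H Λ : Type} [Group H] [Group Λ] [Finite Λ] (φ : Λ → H) (f : H)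
    (N n : ℕ) :
    ∃ (Γ : Type) (_ : Group Γ) (_ : Finite Γ) (e : Λ →* Γ) (t : Γ) (Q : Γ → H) (G : Γ → Λ)
      (len : Γ → ℕ), len 1 = 0 ∧
      (∀ w g, len (w * e g) = len w ∧ Q (w * e g) = Q w ∧ G (w * e g) = G w * g) ∧
      (∀ w, len (w * t) ≤ len w + 1 ∧ len w ≤ len (w * t) + 1 ∧
        (len w < N → Q (w * t) * φ (G (w * t)) = Q w * φ (G w) * f)) ∧
      Function.Injective e ∧
      (∀ (A B : Subgroup Λ) (θ : A ≃* B), ∃ c : Γ, ∀ a : A, c * e a = e (θ a) * c) ∧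
      ∀ (Δ : Type) [Group Δ] [Finite Δ], Nat.card Δ ≤ n →
        ∃ k : Δ →* Γ, Function.Injective k := by
  obtain ⟨C, _, c₀, q, len, τ, hlen, hτ⟩ :=
    exists_finite_ball (fun γ => φ γ * f * (φ γ)⁻¹) N
  let Y := C × Λ × Fin (n + 1)
  let y₀ : Y := (c₀, 1, 0)
  let E : Equiv.Perm Λ →* Equiv.Perm Y :=
    { toFun := fun σ => (Equiv.refl C).prodCongr (σ.prodCongr (Equiv.refl _))
      map_one' := rfl
      map_mul' := fun _ _ => rfl }
  let ρ : Λ →* Equiv.Perm Λ :=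
    { toFun := fun g => Equiv.mulRight g⁻¹
      map_one' := by ext; simp
      map_mul' := fun g g' => by ext; simp [mul_assoc] }
  have hE : ∀ g y, E (ρ g) y = (y.1, y.2.1 * g⁻¹, y.2.2) := fun _ _ => rfl
  let t : Equiv.Perm Y :=
    { toFun := fun y => ((τ y.2.1).symm y.1, y.2)
      invFun := fun y => (τ y.2.1 y.1, y.2)
      left_inv := fun y => by simp
      right_inv := fun y => by simp }
  refine ⟨Equiv.Perm Y, inferInstance, inferInstance, E.comp ρ, t, fun w => q (w⁻¹ y₀).1,
    fun w => (w⁻¹ y₀).2.1, fun w => len (w⁻¹ y₀).1, hlen, fun w g => ?_, fun w => ?_, ?_, ?_, ?_⟩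
  · have h : (w * E.comp ρ g)⁻¹ y₀ = ((w⁻¹ y₀).1, (w⁻¹ y₀).2.1 * g, (w⁻¹ y₀).2.2) := by
      rw [mul_inv_rev, ← map_inv, Equiv.Perm.mul_apply]
      rw [MonoidHom.comp_apply, hE, inv_inv]
    simp only [h, and_self]
  · have h : (w * t)⁻¹ y₀ = (τ (w⁻¹ y₀).2.1 (w⁻¹ y₀).1, (w⁻¹ y₀).2) := by
      rw [mul_inv_rev]
      rfl
    simp only [h]
    obtain ⟨h1, h2, h3⟩ := hτ (w⁻¹ y₀).2.1 (w⁻¹ y₀).1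
    exact ⟨h1, h2, fun hw => by rw [h3 hw]; group⟩
  · intro g g' h
    have := congrArg (fun y : Y => y.2.1) (Equiv.congr_fun h y₀)
    simpa only [MonoidHom.comp_apply, hE, y₀, one_mul, inv_inj] using this
  · intro A B θ
    obtain ⟨c, hc⟩ := exists_perm_mul_eq θ
    refine ⟨E c, fun a => ?_⟩
    rw [MonoidHom.comp_apply, MonoidHom.comp_apply, ← map_mul, ← map_mul]
    congr 1
    ext γ
    simpa [ρ] using hc γ a⁻¹
  · intro Δ _ _ hΔ
    refine exists_injective_hom_perm (hΔ.trans ?_)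
    have : Nonempty C := ⟨c₀⟩
    have h1 : 0 < Nat.card C := Nat.card_pos
    have h2 : 0 < Nat.card Λ := Nat.card_pos
    rw [Nat.card_prod, Nat.card_prod, Nat.card_fin]
    nlinarith [Nat.mul_pos h1 h2]

end Groups

/-- A finite group acting faithfully by partial automorphisms on a finite subset of `U`. -/
structure FinAction {L : Sig} (U : PreStr L) : Type 1 where
  Γ : Type
  [grp : Group Γ]
  [fin : Finite Γ]
  A : Set U.M
  finA : A.Finite
  act : Γ → U.M → U.M
  act_mem : ∀ g, ∀ x ∈ A, act g x ∈ A
  act_one : ∀ x ∈ A, act 1 x = x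
  act_mul : ∀ g h, ∀ x ∈ A, act (g * h) x = act g (act h x)
  good : ∀ g, Good U {p | p.1 ∈ A ∧ p.2 = act g p.1}
  faithful : ∀ g, (∀ x ∈ A, act g x = x) → g = 1

attribute [instance] FinAction.grp FinAction.fin

section Extension

variable {L : Sig} {U : PreStr L}

/-- The pseudo-structure on `Γ × Option U` induced by the maps `(w, x) ↦ p (k * w) x`, where the
points `(w, none)` form a free orbit. -/
noncomputable def translates {Γ : Type} [Group Γ] [Fintype Γ] (p : Γ → U.M → U.M) (x₀ : U.M)
    (m : Γ → ℕ) (ε η : ℝ) (hε : 0 ≤ ε) (hη : 0 ≤ η)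
    (H : ∀ i j (n : ℕ), 1 ≤ L.u i j (ε * n) ∨ η * n ≤ L.u i j (ε * n)) :
    PsStr L (Γ × Option U.M) :=
  PsStr.sup fun o : Option Γ => o.elim
    (PsStr.discrete L fun x => x.2.elim (some x.1) fun _ => none)
    fun k => cone U (fun x => p (k * x.1) (x.2.getD x₀))
      (fun x => x.2.elim 0 fun _ => m (k * x.1)) ε η hε hη H

section translates

variable {Γ : Type} [Group Γ] [Fintype Γ] {p : Γ → U.M → U.M} {x₀ : U.M}
  {m : Γ → ℕ} {ε η : ℝ} {hε : 0 ≤ ε} {hη : 0 ≤ η}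
  {H : ∀ i j (n : ℕ), 1 ≤ L.u i j (ε * n) ∨ η * n ≤ L.u i j (ε * n)}

theorem translates_d_smul (v : Γ) (x y : Γ × Option U.M) :
    (translates p x₀ m ε η hε hη H).d (v * x.1, x.2) (v * y.1, y.2) =
      (translates p x₀ m ε η hε hη H).d x y := by
  have key : ∀ (v : Γ) (x y : Γ × Option U.M),
      (translates p x₀ m ε η hε hη H).d (v * x.1, x.2) (v * y.1, y.2) ≤
        (translates p x₀ m ε η hε hη H).d x y := by
    intro v x y
    refine PsStr.sup_d_le fun o => ?_
    refine le_trans (le_of_eq ?_) (PsStr.le_sup_d (o.map fun k => k * v) x y)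
    rcases o with _ | k
    · refine PsStr.discrete_d_congr ?_
      obtain ⟨w, _ | x⟩ := x <;> obtain ⟨w', _ | y⟩ := y <;> simp
    · simp [cone, mul_assoc]
  refine (key v x y).antisymm ?_
  simpa using key v⁻¹ (v * x.1, x.2) (v * y.1, y.2)

theorem translates_R_smul (v : Γ) (i : L.I) (x : Fin (L.n i) → Γ × Option U.M) :
    (translates p x₀ m ε η hε hη H).R i (fun k => (v * (x k).1, (x k).2)) =
      (translates p x₀ m ε η hε hη H).R i x := by
  have key : ∀ (v : Γ) (x : Fin (L.n i) → Γ × Option U.M),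
      (translates p x₀ m ε η hε hη H).R i (fun k => (v * (x k).1, (x k).2)) ≤
        (translates p x₀ m ε η hε hη H).R i x := by
    intro v x
    refine PsStr.sup_R_le fun o => ?_
    refine le_trans (le_of_eq ?_) (PsStr.le_sup_R (o.map fun k => k * v) i x)
    rcases o with _ | k
    · simp [PsStr.discrete]
    · simp [cone, mul_assoc, Function.comp_def]
  refine (key v x).antisymm ?_
  simpa using key v⁻¹ (fun k => (v * (x k).1, (x k).2))

theorem translates_d_le {v w : Γ} {x y : U.M} {δ : ℝ} (hδ : 0 ≤ δ)
    (h : ∀ k, min (U.d (p (k * v) x) (p (k * w) y) + |ε * m (k * v) - ε * m (k * w)|)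
      (ε * m (k * v) + ε * m (k * w)) ≤ δ) :
    (translates p x₀ m ε η hε hη H).d (v, some x) (w, some y) ≤ δ := by
  refine PsStr.sup_d_le fun o => ?_
  rcases o with _ | k
  · simpa [PsStr.discrete] using hδ
  · exact h k

theorem translates_d_none {v w : Γ} (h : (translates p x₀ m ε η hε hη H).d (v, none) (w, none) = 0) :
    v = w := by
  by_contra hvw
  have := (PsStr.le_sup_d none _ _).trans_eq h
  simp [PsStr.discrete, hvw] at this
  linarith

theorem translates_d_one (hp : ∀ w, Emb U U (p w)) {x y : U.M}
    (hxy : U.d x y ≤ 2 * (ε * m 1)) :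
    (translates p x₀ m ε η hε hη H).d (1, some x) (1, some y) = U.d x y := by
  refine le_antisymm (translates_d_le (U.d_nonneg x y) fun k => (min_le_left _ _).trans ?_) ?_
  · simp [(hp _).2.1]
  · refine le_trans ?_ (PsStr.le_sup_d (some 1) _ _)
    simp only [Option.elim_some, cone, mul_one, Option.getD_some, sub_self, abs_zero, add_zero,
      (hp 1).2.1]
    exact le_min le_rfl (by linarith)

theorem translates_R_one (hp : ∀ w, Emb U U (p w)) (hm : 1 ≤ η * m 1) (i : L.I)
    (x : Fin (L.n i) → U.M) :
    (translates p x₀ m ε η hε hη H).R i (fun k => (1, some (x k))) = U.R i x := by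
  refine le_antisymm (PsStr.sup_R_le fun o => ?_) ?_
  · rcases o with _ | k
    · exact (U.R_mem i x).1
    · refine (min_le_left _ _).trans (le_of_eq ?_)
      exact (hp (k * 1)).2.2 i x
  · refine le_trans ?_ (PsStr.le_sup_R (some 1) _ _)
    refine le_min (le_of_eq ((hp (1 * 1)).2.2 i x).symm) (Finset.le_inf' _ _ fun j _ => ?_)
    simpa using (U.R_mem i x).2.trans hm

end translates

theorem exists_finAction (hU : HasUrysohn U) {Γ : Type} [Group Γ] [Finite Γ] {p : Γ → U.M → U.M}
    (hp : ∀ w, Emb U U (p w)) {m : Γ → ℕ} {ε η : ℝ} (hε : 0 ≤ ε) (hη : 0 ≤ η)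
    (H : ∀ i j (n : ℕ), 1 ≤ L.u i j (ε * n) ∨ η * n ≤ L.u i j (ε * n)) (hm : 1 ≤ η * m 1)
    {F : Set U.M} (hF : F.Finite) (hdiam : ∀ x ∈ F, ∀ y ∈ F, U.d x y ≤ 2 * (ε * m 1)) :
    ∃ (S : FinAction U) (φ : Γ ≃* S.Γ), F ⊆ S.A ∧
      ∀ (v : Γ), ∀ x ∈ F, ∀ y ∈ F, ∀ δ ≥ 0,
        (∀ k, min (U.d (p (k * v) x) (p k y) + |ε * m (k * v) - ε * m k|)
          (ε * m (k * v) + ε * m k) ≤ δ) → U.d (S.act (φ v) x) y ≤ δ := by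
  classical
  have := Fintype.ofFinite Γ
  obtain ⟨x₀⟩ := hU.nonempty
  set Q := translates p x₀ m ε η hε hη H with hQ
  let T₀ : Set (Γ × Option U.M) := (fun x => (1, some x)) '' F
  let T : Set (Γ × Option U.M) := {x | ∀ y ∈ x.2, y ∈ F}
  have hT₀ : T₀ ⊆ T := by
    rintro _ ⟨x, hx, rfl⟩ y hy
    rwa [← Option.some_injective _ hy]
  have hTfin : T.Finite := by
    refine (Set.finite_univ.prod ((hF.image some).insert none)).subset ?_
    rintro ⟨w, _ | x⟩ hx
    · simp
    · exact ⟨trivial, Or.inr ⟨x, hx x rfl, rfl⟩⟩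
  have hj₀ : PresOn Q U T₀ fun x => x.2.getD x₀ := by
    constructor
    · rintro _ ⟨x, hx, rfl⟩ _ ⟨y, hy, rfl⟩
      exact (translates_d_one hp (hdiam x hx y hy)).symm
    · intro i x hx
      choose y _ hy using hx
      obtain rfl : (fun k => (1, some (y k))) = x := funext hy
      exact (translates_R_one hp hm i y).symm
  obtain ⟨j, hj, hjT₀⟩ := hj₀.exists_union hU Q (hF.image _) hTfin
  rw [Set.union_eq_left.2 hT₀] at hj
  have hjF : ∀ x ∈ F, j (1, some x) = x := fun x hx => hjT₀ ⟨x, hx, rfl⟩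
  have hFT : ∀ x ∈ F, ∀ w : Γ, (w, some x) ∈ T := fun x hx w y hy => by
    rwa [← Option.some_injective _ hy]
  let sm : Γ → Γ × Option U.M → Γ × Option U.M := fun v x => (v * x.1, x.2)
  let r : U.M → Γ × Option U.M := fun y => if h : ∃ x ∈ T, j x = y then h.choose else (1, none)
  have hr : ∀ x ∈ T, r (j x) ∈ T ∧ j (r (j x)) = j x := fun x hx => by
    have h : ∃ x' ∈ T, j x' = j x := ⟨x, hx, rfl⟩
    simp only [r, dif_pos h]
    exact h.choose_spec
  let act : Γ → U.M → U.M := fun v y => j (sm v (r y))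
  have hact : ∀ v, ∀ x ∈ T, act v (j x) = j (sm v x) := fun v x hx => by
    obtain ⟨h1, h2⟩ := hr x hx
    refine U.d_eq_zero _ _ ?_
    rw [hj.1 (sm v (r (j x))) h1 (sm v x) hx, translates_d_smul, ← hQ, ← hj.1 _ h1 _ hx, h2,
      U.d_self]
  have hgood : ∀ g, Good U {p | p.1 ∈ j '' T ∧ p.2 = act g p.1} := by
    intro g
    constructor
    · rintro a ⟨⟨x, hx, ha₁⟩, ha₂⟩ b ⟨⟨y, hy, hb₁⟩, hb₂⟩
      rw [ha₂, hb₂, ← ha₁, ← hb₁, hact _ _ hx, hact _ _ hy, hj.1 x hx y hy, hj.1 (sm g x) hx (sm g y) hy, translates_d_smul]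
    · intro i q hq
      choose x hx hqx using fun k => (hq k).1
      have e1 : (fun k => (q k).1) = j ∘ x := funext fun k => (hqx k).symm
      have e2 : (fun k => (q k).2) = j ∘ fun k => sm g (x k) := funext fun k => by
        rw [(hq k).2, ← hqx k, hact _ _ (hx k)]
        rfl
      rw [e1, e2, hj.2 i x hx, hj.2 i (fun k => sm g (x k)) hx, translates_R_smul]
  let S : FinAction U :=
    { Γ := Γ
      A := j '' T
      finA := hTfin.image j
      act := act
      act_mem := by
        rintro g _ ⟨x, hx, rfl⟩
        rw [hact _ _ hx]
        exact ⟨sm g x, hx, rfl⟩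
      act_one := by
        rintro _ ⟨x, hx, rfl⟩
        rw [hact _ _ hx]
        simp [sm]
      act_mul := by
        rintro g h _ ⟨x, hx, rfl⟩
        rw [hact _ _ hx, hact _ _ hx, hact _ (sm h x) hx]
        simp [sm, mul_assoc]
      good := hgood
      faithful := by
        intro g hg
        have h1 : ∀ w : Γ, (w, none) ∈ T := fun w y hy => by simp at hy
        have h2 := hg _ ⟨_, h1 1, rfl⟩
        rw [hact _ _ (h1 1)] at h2
        have h3 := hj.1 (sm g (1, none)) (h1 _) (1, none) (h1 1)
        rw [h2, U.d_self] at h3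
        simpa using translates_d_none h3.symm }
  refine ⟨S, MulEquiv.refl Γ, fun x hx => ⟨_, hFT x hx 1, hjF x hx⟩, fun v x hx y hy δ hδ h => ?_⟩
  have e : S.act v x = j (v, some x) := by
    conv_lhs => rw [← hjF x hx]
    refine (hact v _ (hFT x hx 1)).trans ?_
    simp [sm]
  refine le_trans (le_of_eq ?_) (translates_d_le (v := v) (w := 1) (x := x) (y := y) (p := p)
    (x₀ := x₀) (m := m) (hε := hε) (hη := hη) (H := H) hδ (by simpa using h))
  change U.d (S.act v x) y = _
  rw [e, ← hQ, ← hj.1 _ (hFT x hx v) _ (hFT y hy 1), hjF y hy]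

end Extension

theorem Aut.mul {L : Sig} {U : PreStr L} {f g : Equiv.Perm U.M} (hf : Aut U f) (hg : Aut U g) :
    Aut U (f * g) :=
  ⟨(f * g).bijective, (f * g).injective, fun x y => (hf.2.2.1 _ _).trans (hg.2.2.1 x y),
    fun i x => (hf.2.2.2 i (g ∘ x)).trans (hg.2.2.2 i x)⟩

theorem Aut.inv {L : Sig} {U : PreStr L} {f : Equiv.Perm U.M} (hf : Aut U f) :
    Aut U (f⁻¹ : Equiv.Perm U.M) :=
  ⟨f⁻¹.bijective, f⁻¹.injective, fun x y => by simpa using (hf.2.2.1 (f⁻¹ x) (f⁻¹ y)).symm,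
    fun i x => by simpa [Function.comp_def] using (hf.2.2.2 i (⇑f⁻¹ ∘ x)).symm⟩

/-- The automorphism group of `U`. -/
def PreStr.autGroup {L : Sig} (U : PreStr L) : Subgroup (Equiv.Perm U.M) where
  carrier := {f | Aut U f}
  one_mem' := ⟨Function.bijective_id, Function.injective_id, fun _ _ => rfl, fun _ _ => rfl⟩
  mul_mem' := Aut.mul
  inv_mem' := Aut.inv

/-- A linear lower bound for all moduli on the multiples of `ε`, below the level `1`. -/
theorem Sig.exists_slope {L : Sig} (hL : ∀ i j, BddAbove (L.Ival i j)) {ε : ℝ} (hε : 0 < ε) :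
    ∃ η > 0, ∀ i j (n : ℕ), 1 ≤ L.u i j (ε * n) ∨ η * n ≤ L.u i j (ε * n) := by
  have := L.finI
  have key : ∀ i j, ∀ᶠ η in nhdsWithin (0 : ℝ) (Set.Ioi 0), ∀ n : ℕ,
      1 ≤ L.u i j (ε * n) ∨ η * n ≤ L.u i j (ε * n) := by
    intro i j
    obtain ⟨C, hC⟩ := hL i j
    have hD : 0 < |C| / ε + 1 := by positivity
    filter_upwards [Ioo_mem_nhdsGT (div_pos (L.u_pos i j ε hε) hD)] with η hη n
    by_contra! h
    obtain ⟨h1, h2⟩ := h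
    rcases Nat.eq_zero_or_pos n with rfl | hn
    · simp [L.u_zero] at h2
    have hn' : (1 : ℝ) ≤ n := by exact_mod_cast hn
    have h3 : ε * n ≤ C := hC ⟨by positivity, h1⟩
    have h4 : (n : ℝ) ≤ |C| / ε + 1 := by
      have : (n : ℝ) ≤ |C| / ε := (le_div_iff₀' hε).2 (h3.trans (le_abs_self C))
      linarith
    have h5 : L.u i j ε ≤ L.u i j (ε * n) :=
      L.u_mono i j hε.le (by positivity : (0 : ℝ) ≤ ε * n) (le_mul_of_one_le_right hε.le hn')
    have h6 := (lt_div_iff₀ hD).1 hη.2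
    have h7 : η * n ≤ η * (|C| / ε + 1) := mul_le_mul_of_nonneg_left h4 hη.1.le
    linarith
  have h := Filter.eventually_all.2 fun i => Filter.eventually_all.2 fun j => key i j
  obtain ⟨η, h1, h2⟩ := (h.and self_mem_nhdsWithin).exists
  exact ⟨η, h2, h1⟩

namespace FinAction

variable {L : Sig} {U : PreStr L}

/-- An equivariant inclusion of finite actions along which isomorphic subgroups become
conjugate. -/
structure Ext (S S' : FinAction U) where
  hom : S.Γ →* S'.Γ
  injective : Function.Injective hom
  subset : S.A ⊆ S'.A
  act_hom : ∀ g, ∀ x ∈ S.A, S'.act (hom g) x = S.act g x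
  conj : ∀ (H K : Subgroup S.Γ) (θ : H ≃* K), ∃ c : S'.Γ, ∀ h : H, c * hom h = hom (θ h) * c

theorem exists_ext (hL : ∀ i j, BddAbove (L.Ival i j)) (hU : HasUrysohn U) (hc : U.IsComplete)
    {D : ℕ → U.M} (hD : ∀ x, ∀ ε > 0, ∃ n, U.d x (D n) < ε) (S : FinAction U)
    {f : Equiv.Perm U.M} (hf : Aut U f) {F : Set U.M} (hF : F.Finite) {ε : ℝ} (hε : 0 < ε)
    (n : ℕ) :
    ∃ (S' : FinAction U) (_ : Ext S S'), F ⊆ S'.A ∧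
      (∃ t, ∀ x ∈ F, U.d (S'.act t x) (f x) ≤ ε) ∧
      ∀ (Δ : Type) [Group Δ] [Finite Δ], Nat.card Δ ≤ n →
        ∃ k : Δ →* S'.Γ, Function.Injective k := by
  obtain ⟨η, hη, H⟩ := Sig.exists_slope hL hε
  have hφ : ∀ γ, ∃ φ : U.autGroup, ∀ x ∈ S.A, φ.1 x = S.act γ x := fun γ => by
    obtain ⟨φ, h1, h2⟩ := Good.exists_aut_of_finite hU hc hD
      (S := {p | p.1 ∈ S.A ∧ p.2 = S.act γ p.1})
      ((S.finA.image fun x => (x, S.act γ x)).subset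
        fun p hp => ⟨p.1, hp.1, Prod.ext rfl hp.2.symm⟩) (S.good γ)
    exact ⟨⟨φ, h1⟩, fun x hx => h2 (x, S.act γ x) ⟨hx, rfl⟩⟩
  choose φ hφ using hφ
  set F' := S.A ∪ (F ∪ f '' F) with hF'
  have hF'fin : F'.Finite := S.finA.union (hF.union (hF.image f))
  obtain ⟨B, hB⟩ := ((hF'fin.prod hF'fin).image fun p => U.d p.1 p.2).bddAbove
  obtain ⟨N, hN⟩ := exists_nat_ge (max (1 / η) (B / (2 * ε)))
  have hN₁ : 1 ≤ η * N := (div_le_iff₀' hη).1 ((le_max_left _ _).trans hN)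
  have hN₂ : B ≤ 2 * (ε * N) := by
    have := (div_le_iff₀' (by positivity : 0 < 2 * ε)).1 ((le_max_right _ _).trans hN)
    linarith
  obtain ⟨Γ, _, _, e, t, Q, G, len, hlen, he, ht, hinj, hconj, huniv⟩ :=
    exists_finite_model φ ⟨f, hf⟩ N n
  obtain ⟨S', ψ, hS', hd⟩ := exists_finAction hU (p := fun w => (Q w * φ (G w)).1)
    (fun w => (Q w * φ (G w)).2.2) (m := fun w => N - len w) hε.le hη.le H
    (by simpa [hlen] using hN₁) hF'fin
    (fun x hx y hy => by
      simpa [hlen] using (hB ⟨(x, y), ⟨hx, hy⟩, rfl⟩).trans hN₂)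
  refine ⟨S', ⟨ψ.toMonoidHom.comp e, ψ.injective.comp hinj,
    Set.subset_union_left.trans hS', fun g x hx => ?_, fun A B θ => ?_⟩,
    (Set.subset_union_left.trans Set.subset_union_right).trans hS', ⟨ψ t, fun x hx => ?_⟩,
    fun Δ _ _ hΔ => ?_⟩
  · refine U.d_eq_zero _ _ (le_antisymm ?_ (U.d_nonneg _ _))
    refine hd (e g) x (Or.inl hx) _ (Or.inl (S.act_mem g x hx)) 0 le_rfl fun k => ?_
    refine (min_le_left _ _).trans (le_of_eq ?_)
    obtain ⟨h1, h2, h3⟩ := he k g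
    simp only [h1, h2, h3, sub_self, abs_zero, add_zero, Subgroup.coe_mul, Equiv.Perm.mul_apply]
    rw [hφ _ _ hx, hφ _ _ (S.act_mem g x hx), S.act_mul _ _ _ hx, U.d_self]
  · obtain ⟨c, hc⟩ := hconj A B θ
    exact ⟨ψ c, fun a => by simpa using congrArg ψ (hc a)⟩
  · refine hd t x (Or.inr (Or.inl hx)) _ (Or.inr (Or.inr ⟨x, hx, rfl⟩)) ε hε.le fun k => ?_
    obtain ⟨h1, h2, h3⟩ := ht k
    by_cases hk : len k < N
    · refine (min_le_left _ _).trans ?_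
      simp only [h3 hk, Subgroup.coe_mul, Equiv.Perm.mul_apply, U.d_self, zero_add]
      rw [← mul_sub, abs_mul, abs_of_pos hε]
      refine mul_le_of_le_one_right hε.le (abs_le.2 ⟨?_, ?_⟩)
      · have : ((N - len k : ℕ) : ℝ) ≤ (N - len (k * t) : ℕ) + 1 := by
          exact_mod_cast (by omega : N - len k ≤ N - len (k * t) + 1)
        linarith
      · have : ((N - len (k * t) : ℕ) : ℝ) ≤ (N - len k : ℕ) + 1 := by
          exact_mod_cast (by omega : N - len (k * t) ≤ N - len k + 1)
        linarith
    · refine (min_le_right _ _).trans ?_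
      have e1 : N - len k = 0 := by omega
      have e2 : ((N - len (k * t) : ℕ) : ℝ) ≤ 1 := by
        exact_mod_cast (by omega : N - len (k * t) ≤ 1)
      simp only [e1, Nat.cast_zero, mul_zero, add_zero]
      exact mul_le_of_le_one_right hε.le e2
  · obtain ⟨k, hk⟩ := huniv Δ hΔ
    exact ⟨ψ.toMonoidHom.comp k, ψ.injective.comp hk⟩

end FinAction

section Tower

variable {L : Sig} {U : PreStr L}

theorem Aut.ext_of_dense {D : ℕ → U.M} (hD : ∀ x, ∀ ε > 0, ∃ n, U.d x (D n) < ε)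
    {f g : Equiv.Perm U.M} (hf : Aut U f) (hg : Aut U g) (h : ∀ i, f (D i) = g (D i)) :
    f = g := by
  ext x
  refine U.d_eq_zero _ _ (le_antisymm (le_of_forall_pos_le_add fun ε hε => ?_) (U.d_nonneg _ _))
  obtain ⟨i, hi⟩ := hD x (ε / 2) (half_pos hε)
  have h1 := U.d_triangle (f x) (f (D i)) (g x)
  have h2 := hf.2.2.1 x (D i)
  have h3 := hg.2.2.1 (D i) x
  rw [U.d_comm (D i)] at h3
  rw [h i] at h1 h2
  linarith

namespace FinAction

variable {S : ℕ → FinAction U}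

/-- The transition maps of a tower of finite actions. -/
def transition (E : ∀ n, Ext (S n) (S (n + 1))) {n m : ℕ} (h : n ≤ m) : (S n).Γ → (S m).Γ :=
  Nat.leRecOn h fun {k} => (E k).hom

theorem transition_succ (E : ∀ n, Ext (S n) (S (n + 1))) {n m : ℕ} (h : n ≤ m) (g : (S n).Γ) :
    transition E (Nat.le_succ_of_le h) g = (E m).hom (transition E h g) :=
  Nat.leRecOn_succ (C := fun n => (S n).Γ) h g

theorem transition_mul (E : ∀ n, Ext (S n) (S (n + 1))) {n m : ℕ} (h : n ≤ m) (g g' : (S n).Γ) :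
    transition E h (g * g') = transition E h g * transition E h g' := by
  induction m, h using Nat.le_induction with
  | base => simp only [transition, Nat.leRecOn_self]
  | succ m h ih => rw [transition_succ E h, transition_succ E h, transition_succ E h, ih, map_mul]

theorem monotone_A (E : ∀ n, Ext (S n) (S (n + 1))) : Monotone fun n => (S n).A :=
  monotone_nat_of_le_succ fun n => (E n).subset

/-- The limit of a tower of finite actions with dense union. -/
theorem exists_limit (hc : U.IsComplete) {D : ℕ → U.M}
    (hD : ∀ x, ∀ ε > 0, ∃ n, U.d x (D n) < ε) (E : ∀ n, Ext (S n) (S (n + 1)))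
    (hDA : ∀ i, ∃ n, D i ∈ (S n).A) :
    ∃ α : ∀ n, (S n).Γ →* Equiv.Perm U.M, (∀ n g, Aut U (α n g)) ∧
      (∀ n, Function.Injective (α n)) ∧ (∀ n g, α (n + 1) ((E n).hom g) = α n g) ∧
      ∀ n g, ∀ x ∈ (S n).A, α n g x = (S n).act g x := by
  have hmem : ∀ n i, ∃ m, n ≤ m ∧ D i ∈ (S m).A := fun n i => by
    obtain ⟨m, hm⟩ := hDA i
    exact ⟨max n m, le_max_left _ _, monotone_A E (le_max_right n m) hm⟩
  have hex : ∀ n (g : (S n).Γ), ∃ f : Equiv.Perm U.M, Aut U f ∧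
      ∀ m (h : n ≤ m), ∀ x ∈ (S m).A, f x = (S m).act (transition E h g) x := by
    intro n g
    have hm : Monotone fun k => {p : U.M × U.M | p.1 ∈ (S (n + k)).A ∧
        p.2 = (S (n + k)).act (transition E (Nat.le_add_right n k) g) p.1} := by
      refine monotone_nat_of_le_succ fun k p hp => ⟨(E (n + k)).subset hp.1, hp.2.trans ?_⟩
      exact ((E (n + k)).act_hom _ _ hp.1).symm.trans
        (congrArg (fun γ => (S (n + k + 1)).act γ p.1)
          (transition_succ E (Nat.le_add_right n k) g).symm)
    obtain ⟨f, hf, hfS⟩ := (Good.iUnion hm fun k => (S (n + k)).good _).exists_aut hc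
      (fun x ε hε => by
        obtain ⟨i, hi⟩ := hD x ε hε
        obtain ⟨m, hnm, hm⟩ := hmem n i
        obtain ⟨k, rfl⟩ := Nat.exists_eq_add_of_le hnm
        exact ⟨(D i, (S (n + k)).act (transition E (Nat.le_add_right n k) g) (D i)),
          Set.mem_iUnion.2 ⟨k, hm, rfl⟩, hi⟩)
      (fun x ε hε => by
        obtain ⟨i, hi⟩ := hD x ε hε
        obtain ⟨m, hnm, hm⟩ := hmem n i
        obtain ⟨k, rfl⟩ := Nat.exists_eq_add_of_le hnm
        set γ := transition E (Nat.le_add_right n k) g with hγ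
        refine ⟨((S (n + k)).act γ⁻¹ (D i), D i),
          Set.mem_iUnion.2 ⟨k, (S (n + k)).act_mem _ _ hm, ?_⟩, hi⟩
        change D i = (S (n + k)).act γ ((S (n + k)).act γ⁻¹ (D i))
        rw [← (S (n + k)).act_mul _ _ _ hm, mul_inv_cancel, (S (n + k)).act_one _ hm])
    refine ⟨f, hf, fun m h x hx => ?_⟩
    obtain ⟨k, rfl⟩ := Nat.exists_eq_add_of_le h
    exact hfS (x, _) (Set.mem_iUnion.2 ⟨k, hx, rfl⟩)
  choose α hα hact using hex
  have hact₀ : ∀ n g, ∀ x ∈ (S n).A, α n g x = (S n).act g x := fun n g x hx => by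
    have := hact n g n le_rfl x hx
    rwa [transition, Nat.leRecOn_self] at this
  have hmul : ∀ n g g', α n (g * g') = α n g * α n g' := fun n g g' => by
    refine Aut.ext_of_dense hD (hα _ _) ((hα _ _).mul (hα _ _)) fun i => ?_
    obtain ⟨m, hnm, hm⟩ := hmem n i
    rw [Equiv.Perm.mul_apply, hact n g' m hnm _ hm, hact n g m hnm _ ((S m).act_mem _ _ hm),
      ← (S m).act_mul _ _ _ hm, ← transition_mul, hact n _ m hnm _ hm]
  refine ⟨fun n => MonoidHom.mk' (α n) (hmul n), hα, fun n => ?_, fun n g => ?_, hact₀⟩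
  · refine (injective_iff_map_eq_one _).2 fun g hg => (S n).faithful g fun x hx => ?_
    rw [← hact₀ n g x hx]
    exact congrArg (fun f : Equiv.Perm U.M => f x) hg
  · refine Aut.ext_of_dense hD (hα _ _) (hα _ _) fun i => ?_
    obtain ⟨m, hnm, hm⟩ := hmem (n + 1) i
    have hn := (Nat.le_succ n).trans hnm
    refine (hact (n + 1) _ m hnm _ hm).trans (Eq.trans ?_ (hact n g m hn _ hm).symm)
    exact congrArg (fun γ => (S m).act γ (D i))
      (Nat.leRecOn_succ_left (C := fun n => (S n).Γ) g hn hnm)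

/-- The trivial group acting on the empty set. -/
def trivial (U : PreStr L) : FinAction U where
  Γ := Unit
  A := ∅
  finA := Set.finite_empty
  act _ x := x
  act_mem _ _ h := h
  act_one _ _ := rfl
  act_mul _ _ _ _ := rfl
  good _ := ⟨fun _ hp => hp.1.elim, fun i _ hx => (hx ⟨0, L.n_pos i⟩).1.elim⟩
  faithful _ _ := rfl

theorem exists_tower (hL : ∀ i j, BddAbove (L.Ival i j)) (hU : HasUrysohn U) (hc : U.IsComplete)
    {D : ℕ → U.M} (hD : ∀ x, ∀ ε > 0, ∃ n, U.d x (D n) < ε) {f : ℕ → Equiv.Perm U.M}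
    (hf : ∀ n, Aut U (f n)) {F : ℕ → Set U.M} (hF : ∀ n, (F n).Finite) {ε : ℕ → ℝ}
    (hε : ∀ n, 0 < ε n) :
    ∃ (S : ℕ → FinAction U) (_ : ∀ n, Ext (S n) (S (n + 1))), ∀ n, F n ⊆ (S (n + 1)).A ∧
      (∃ t, ∀ x ∈ F n, U.d ((S (n + 1)).act t x) (f n x) ≤ ε n) ∧
      ∀ (Δ : Type) [Group Δ] [Finite Δ], Nat.card Δ ≤ n →
        ∃ k : Δ →* (S (n + 1)).Γ, Function.Injective k := by
  choose next E h using fun n (S : FinAction U) =>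
    exists_ext hL hU hc hD S (hf n) (hF n) (hε n) n
  let S : ℕ → FinAction U := fun n => Nat.rec (trivial U) next n
  exact ⟨S, fun n => E n (S n), fun n => h n (S n)⟩

end FinAction

/-- Countably many finite approximation problems whose solutions are dense in `Aut U`. -/
theorem exists_approximation_seq {D : ℕ → U.M} (hD : ∀ x, ∀ ε > 0, ∃ n, U.d x (D n) < ε) :
    ∃ (f : ℕ → Equiv.Perm U.M) (F : ℕ → Set U.M) (ε : ℕ → ℝ), (∀ n, Aut U (f n)) ∧
      (∀ n, (F n).Finite) ∧ (∀ n, 0 < ε n) ∧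
      ∀ g : Equiv.Perm U.M, Aut U g → ∀ (m : ℕ) (xs : Fin m → U.M) (ε₀ : ℝ), 0 < ε₀ →
        ∃ n, ∀ t : Equiv.Perm U.M, Aut U t → (∀ x ∈ F n, U.d (t x) (f n x) ≤ ε n) →
          ∀ k, U.d (g (xs k)) (t (xs k)) < ε₀ := by
  classical
  have hex : ∀ c : Finset (ℕ × ℕ) × ℕ, ∃ f : Equiv.Perm U.M, Aut U f ∧
      ∀ g : Equiv.Perm U.M, Aut U g →
        (∀ p ∈ c.1, U.d (g (D p.1)) (D p.2) < 1 / ((c.2 : ℝ) + 1)) →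
        ∀ p ∈ c.1, U.d (f (D p.1)) (D p.2) < 1 / ((c.2 : ℝ) + 1) := fun c => by
    by_cases h : ∃ g : Equiv.Perm U.M, Aut U g ∧
      ∀ p ∈ c.1, U.d (g (D p.1)) (D p.2) < 1 / ((c.2 : ℝ) + 1)
    · obtain ⟨g, hg, hgc⟩ := h
      exact ⟨g, hg, fun _ _ _ => hgc⟩
    · exact ⟨1, U.autGroup.one_mem, fun g hg hgc => absurd ⟨g, hg, hgc⟩ h⟩
  choose f hf hfc using hex
  obtain ⟨σ, hσ⟩ := exists_surjective_nat (Finset (ℕ × ℕ) × ℕ)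
  refine ⟨fun n => f (σ n), fun n => (fun p : ℕ × ℕ => D p.1) '' (σ n).1,
    fun n => 1 / (((σ n).2 : ℝ) + 1), fun n => hf _, fun n => (σ n).1.finite_toSet.image _,
    fun n => by positivity, fun g hg m xs ε₀ hε₀ => ?_⟩
  obtain ⟨N, hN⟩ := exists_nat_one_div_lt (by positivity : 0 < ε₀ / 5)
  have hδ : 0 < 1 / ((N : ℝ) + 1) := by positivity
  choose a ha using fun k => hD (xs k) _ hδ
  choose b hb using fun k => hD (g (D (a k))) _ hδ
  obtain ⟨n, hn⟩ := hσ (Finset.univ.image fun k => (a k, b k), N)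
  have hgn : ∀ p ∈ (σ n).1, U.d (g (D p.1)) (D p.2) < 1 / (((σ n).2 : ℝ) + 1) := by
    rw [hn]
    intro p hp
    obtain ⟨k, -, rfl⟩ := Finset.mem_image.1 hp
    exact hb k
  refine ⟨n, fun t ht h k => ?_⟩
  have hk : (a k, b k) ∈ (σ n).1 := by
    rw [hn]
    exact Finset.mem_image_of_mem _ (Finset.mem_univ k)
  have h1 : U.d (f (σ n) (D (a k))) (D (b k)) < 1 / (((σ n).2 : ℝ) + 1) := hfc _ g hg hgn _ hk
  have h2 : U.d (t (D (a k))) (f (σ n) (D (a k))) ≤ 1 / (((σ n).2 : ℝ) + 1) := h _ ⟨_, hk, rfl⟩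
  have hσN : (σ n).2 = N := by rw [hn]
  rw [hσN] at h1 h2
  have h4 := hg.2.2.1 (xs k) (D (a k))
  have h5 := ht.2.2.1 (D (a k)) (xs k)
  have h6 := U.d_triangle (g (xs k)) (g (D (a k))) (t (xs k))
  have h7 := U.d_triangle (g (D (a k))) (D (b k)) (t (xs k))
  have h8 := U.d_triangle (D (b k)) (f (σ n) (D (a k))) (t (xs k))
  have h9 := U.d_triangle (f (σ n) (D (a k))) (t (D (a k))) (t (xs k))
  rw [U.d_comm (D (b k)) (f _ _)] at h8
  rw [U.d_comm (f _ _) (t (D _))] at h9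
  rw [U.d_comm (D (a k))] at h5
  linarith [ha k, hb k]

end Tower

/-- The union of an increasing sequence of finite groups in which all finite groups embed and
isomorphic subgroups of each stage are conjugate in the next is Hall's group. -/
theorem hall_of_tower {P : Type} [Group P] {Γ : ℕ → Type} [∀ n, Group (Γ n)] [∀ n, Finite (Γ n)]
    {α : ∀ n, Γ n →* P} (hα : ∀ n, Function.Injective (α n)) {e : ∀ n, Γ n →* Γ (n + 1)}
    (he : ∀ n g, α (n + 1) (e n g) = α n g)
    (huniv : ∀ (Δ : Type) [Group Δ] [Finite Δ], ∃ n, ∃ k : Δ →* Γ n, Function.Injective k)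
    (hconj : ∀ n (A B : Subgroup (Γ n)) (θ : A ≃* B), ∃ c : Γ (n + 1),
      ∀ a : A, c * e n a = e n (θ a) * c) :
    ∃ G : Subgroup P, (∀ g, g ∈ G ↔ ∃ n γ, α n γ = g) ∧ Countable G ∧
      (∀ S : Set P, S ⊆ G → S.Finite → Finite (Subgroup.closure S)) ∧
      (∀ (Δ : Type) [Group Δ], Finite Δ →
        ∃ k : Δ → G, Function.Injective k ∧ ∀ a b : Δ, k (a * b) = k a * k b) ∧
      ∀ H K : Subgroup P, H ≤ G → K ≤ G → Finite H → Finite K →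
        ∀ θ : H → K, Function.Bijective θ → (∀ a b : H, θ (a * b) = θ a * θ b) →
          ∃ g ∈ G, ∀ h : H, (θ h : P) = g * h * g⁻¹ := by
  have hmono : Monotone fun n => (α n).range := monotone_nat_of_le_succ fun n => by
    rintro _ ⟨γ, rfl⟩
    exact ⟨e n γ, he n γ⟩
  have hG : ∀ g, g ∈ ⨆ n, (α n).range ↔ ∃ n γ, α n γ = g := fun g => by
    rw [Subgroup.mem_iSup_of_directed hmono.directed_le]
    rfl
  have hfin : ∀ S : Set P, S ⊆ (⨆ n, (α n).range : Subgroup P) → S.Finite →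
      ∃ n, S ⊆ (α n).range := by
    intro S hS hSf
    have := hSf.to_subtype
    choose ν hν using fun s : S => (hG s).1 (hS s.2)
    obtain ⟨n, hn⟩ := (Set.finite_range ν).bddAbove
    exact ⟨n, fun s hs => hmono (hn ⟨⟨s, hs⟩, rfl⟩) (hν ⟨s, hs⟩)⟩
  refine ⟨⨆ n, (α n).range, hG, ?_, fun S hS hSf => ?_, fun Δ _ _ => ?_,
    fun H K hH hK _ _ θ hθ hmul => ?_⟩
  · have : ((⨆ n, (α n).range : Subgroup P) : Set P) = ⋃ n, Set.range (α n) := by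
      ext g
      simp [hG]
    exact ((Set.countable_iUnion fun n => Set.countable_range (α n)).mono this.le).to_subtype
  · obtain ⟨n, hn⟩ := hfin S hS hSf
    exact ((Set.finite_range (α n)).subset ((Subgroup.closure_le _).2 hn)).to_subtype
  · obtain ⟨n, k, hk⟩ := huniv Δ
    exact ⟨fun a => ⟨α n (k a), (hG _).2 ⟨n, _, rfl⟩⟩,
      fun a b h => hk (hα n (congrArg Subtype.val h)), fun a b => Subtype.ext (by simp)⟩
  · obtain ⟨n, hn⟩ := hfin (H ∪ K) (Set.union_subset hH hK)
      ((Set.toFinite (H : Set P)).union (Set.toFinite (K : Set P)))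
    have hpull : ∀ M : Subgroup P, M ≤ (α n).range →
        ∃ t : M.comap (α n) ≃* M, ∀ γ, (t γ : P) = α n γ := fun M hM =>
      ⟨((M.comap (α n)).equivMapOfInjective (α n) (hα n)).trans
        (MulEquiv.subgroupCongr (Subgroup.map_comap_eq_self hM)), fun _ => rfl⟩
    obtain ⟨s, hs⟩ := hpull H fun x hx => hn (Or.inl hx)
    obtain ⟨t, ht⟩ := hpull K fun x hx => hn (Or.inr hx)
    obtain ⟨θ', hθ'⟩ : ∃ θ' : H ≃* K, ∀ h, θ' h = θ h :=
      ⟨MulEquiv.mk' (Equiv.ofBijective θ hθ) hmul, fun _ => rfl⟩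
    obtain ⟨c, hc⟩ := hconj n _ _ ((s.trans θ').trans t.symm)
    refine ⟨α (n + 1) c, (hG _).2 ⟨_, _, rfl⟩, fun h => eq_mul_inv_of_mul_eq ?_⟩
    have h1 := congrArg (α (n + 1)) (hc (s.symm h))
    rw [map_mul, map_mul, he, he, ← hs, ← ht] at h1
    simpa [hθ'] using h1.symm

/-- Theorem (paper Thm 1.6 / Cor 8.6): let `L` be proper and `U` a separable
continuous `L`-structure with the Urysohn property.  Then the automorphism
group of `U` (as a subgroup of the permutation group of `U`) contains a dense
subgroup isomorphic to Hall's universal locally finite group: a countable,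
locally finite group into which every finite group embeds, such that every
isomorphism between two of its finite subgroups is induced by conjugation, and
which is dense in `Aut(U)` for the topology of pointwise convergence. -/
theorem stmt19 (L : Sig) (hL : L.Proper) (U : PreStr L)
    (hcomp : U.IsComplete) (hsep : U.Separable) (hU : HasUrysohn U) :
    ∃ G : Subgroup (Equiv.Perm U.M),
      -- G consists of automorphisms of U
      (∀ f : Equiv.Perm U.M, f ∈ G → Aut U ⇑f) ∧
      -- G is countable
      Countable ↥G ∧
      -- G is locally finite
      (∀ S : Set (Equiv.Perm U.M), S ⊆ ↑G → S.Finite →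
        Finite ↥(Subgroup.closure S)) ∧
      -- every finite group embeds into G
      (∀ (Γ : Type) [Group Γ], Finite Γ →
        ∃ e : Γ → ↥G, Function.Injective e ∧ ∀ a b : Γ, e (a * b) = e a * e b) ∧
      -- every isomorphism between finite subgroups of G is induced by
      -- conjugation by an element of G
      (∀ H K : Subgroup (Equiv.Perm U.M), H ≤ G → K ≤ G → Finite ↥H → Finite ↥K →
        ∀ θ : ↥H → ↥K, Function.Bijective θ → (∀ a b : ↥H, θ (a * b) = θ a * θ b) →
          ∃ g ∈ G, ∀ h : ↥H,
            ((θ h : Equiv.Perm U.M)) = g * (↑h : Equiv.Perm U.M) * g⁻¹) ∧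
      -- G is dense in Aut(U) in the topology of pointwise convergence
      (∀ f : Equiv.Perm U.M, Aut U ⇑f →
        ∀ (m : ℕ) (xs : Fin m → U.M), ∀ ε : ℝ, 0 < ε →
          ∃ g ∈ G, ∀ k : Fin m, U.d (f (xs k)) (g (xs k)) < ε) := by
  have : Nonempty U.M := hU.nonempty
  obtain ⟨D₀, hD₀, hd⟩ := hsep
  have hne : D₀.Nonempty := (hd (Classical.arbitrary _) 1 one_pos).imp fun _ h => h.1
  obtain ⟨D, rfl⟩ := hD₀.exists_eq_range hne
  have hD : ∀ x, ∀ ε > 0, ∃ n, U.d x (D n) < ε := fun x ε hε => by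
    obtain ⟨_, ⟨n, rfl⟩, hn⟩ := hd x ε hε
    exact ⟨n, hn⟩
  obtain ⟨f, F, ε, hf, hF, hε, hdense⟩ := exists_approximation_seq hD
  obtain ⟨S, E, hS⟩ := FinAction.exists_tower hL.1.1 hU hcomp hD hf
    (fun n => (hF n).union (Set.finite_singleton (D n))) hε
  obtain ⟨α, hα, hinj, hE, hact⟩ := FinAction.exists_limit hcomp hD E
    fun i => ⟨i + 1, (hS i).1 (Or.inr rfl)⟩
  obtain ⟨G, hG, hcount, hlf, huniv, hconj⟩ := hall_of_tower hinj hE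
    (fun Δ _ _ => ⟨_, (hS (Nat.card Δ)).2.2 Δ le_rfl⟩) fun n => (E n).conj
  refine ⟨G, fun g hg => ?_, hcount, hlf, huniv, hconj, fun g hg m xs ε₀ hε₀ => ?_⟩
  · obtain ⟨n, γ, rfl⟩ := (hG g).1 hg
    exact hα n γ
  · obtain ⟨n, hn⟩ := hdense g hg m xs ε₀ hε₀
    obtain ⟨hFA, ⟨t, ht⟩, -⟩ := hS n
    refine ⟨α (n + 1) t, (hG _).2 ⟨_, _, rfl⟩, hn _ (hα _ _) fun x hx => ?_⟩
    rw [hact _ _ _ (hFA (Or.inl hx))]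
    exact ht x (Or.inl hx)

end ContLogic
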